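/- arXiv:1905.05459 — 2 statements merged into one kernel-verified Lean document; each statement's English description precedes it below -/
import Mathlib

section
/- Let α ∈ (1,2), c > 1, θ admissible, φ the measure on (−∞,0) with φ((−∞,−x)) = x^{−α}θ(log x), ψ(z) = ∫_{(−∞,0)} (e^{izx} − 1 − izx) dφ(x), and for s > 0 let ξ(s) > 0 be the unique positive real with ψ(−i·ξ(s)) = s. Let p: ℝ × (0,∞) → [0,∞) be jointly continuous such that for every t > 0, x ↦ p(x,t) is integrable with Fourier transform ∫_ℝ e^{ikx} p(x,t) dx = exp(t·ψ(k)) for all k ∈ ℝ (the density of the negatively skewed semistable Lévy process). Then for all x > 0 and s > 0: ∫_0^∞ e^{−st} p(x,t) dt = exp(−x·ξ(s)) / s'(ξ(s)), where s'(k) = ∫_{(−∞,0)} y·(e^{ky} − 1) dφ(y) is the derivative of k ↦ ψ(−ik). -/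
open MeasureTheory Set Filter

/-- The log-characteristic function of a negatively skewed semistable law with Levy
measure `φm` concentrated on the negative half-line:
`ψ(z) = ∫_{(-∞,0)} (e^{izx} - 1 - izx) dφ(x)`. -/
noncomputable def psiSemi (φm : MeasureTheory.Measure ℝ) (z : ℂ) : ℂ :=
  ∫ x in Set.Iio (0 : ℝ),
    (Complex.exp (Complex.I * z * (x : ℂ)) - 1 - Complex.I * z * (x : ℂ)) ∂φm


structure LevyB (μ : Measure ℝ) (α m M : ℝ) : Prop where
  h1 : 1 < α
  h2 : α < 2
  hm : 0 < m
  hM : 0 < M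
  neg : ∀ᵐ y ∂μ, y < 0
  lo : ∀ x : ℝ, 0 < x → ENNReal.ofReal (m * x ^ (-α)) ≤ μ (Iio (-x))
  hi : ∀ x : ℝ, 0 < x → μ (Iio (-x)) ≤ ENNReal.ofReal (M * x ^ (-α))

namespace LevyB
variable {μ : Measure ℝ} {α m M : ℝ}

theorem integrable_min (h : LevyB μ α m M) : Integrable (fun y : ℝ => min |y| (y ^ 2)) μ := by
  have hcont : Continuous (fun y : ℝ => min |y| (y ^ 2)) := by fun_prop
  refine ⟨hcont.aestronglyMeasurable, ?_⟩
  have hnn : ∀ y : ℝ, 0 ≤ min |y| (y ^ 2) := fun y => le_min (abs_nonneg _) (sq_nonneg _)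
  rw [hasFiniteIntegral_iff_ofReal (Eventually.of_forall hnn),
    lintegral_eq_lintegral_meas_lt μ (Eventually.of_forall hnn) hcont.aemeasurable]
  have h1 := h.h1
  have h2 := h.h2
  have hb1 : ∀ t ∈ Ioc (0 : ℝ) 1, μ {a : ℝ | t < min |a| (a ^ 2)} ≤ ENNReal.ofReal (M * t ^ (-α/2)) := by
    intro t ht
    have hs : 0 < Real.sqrt t := Real.sqrt_pos.2 ht.1
    have : μ {a : ℝ | t < min |a| (a ^ 2)} ≤ μ (Iio (-(Real.sqrt t))) := by
      apply measure_mono_ae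
      filter_upwards [h.neg] with y hy hy2
      have hy2' : t < y ^ 2 := (lt_min_iff.1 hy2).2
      have : Real.sqrt t < -y := by
        rw [Real.sqrt_lt' (by linarith)]; nlinarith
      exact lt_neg_of_lt_neg this
    refine this.trans ((h.hi _ hs).trans (le_of_eq ?_))
    congr 2
    rw [Real.sqrt_eq_rpow, ← Real.rpow_mul ht.1.le]; congr 1; ring
  have hb2 : ∀ t ∈ Ioi (1 : ℝ), μ {a : ℝ | t < min |a| (a ^ 2)} ≤ ENNReal.ofReal (M * t ^ (-α)) := by
    intro t ht
    have ht0 : (0:ℝ) < t := lt_trans one_pos ht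
    have : μ {a : ℝ | t < min |a| (a ^ 2)} ≤ μ (Iio (-t)) := by
      apply measure_mono_ae
      filter_upwards [h.neg] with y hy hy2
      have hy2' : t < |y| := (lt_min_iff.1 hy2).1
      rw [abs_of_neg hy] at hy2'
      exact lt_neg_of_lt_neg hy2'
    exact this.trans (h.hi _ ht0)
  have hsplit : Ioi (0:ℝ) = Ioc 0 1 ∪ Ioi 1 := by
    rw [Ioc_union_Ioi_eq_Ioi zero_le_one]
  rw [hsplit]
  refine (lintegral_union_le _ _ _).trans_lt (ENNReal.add_lt_top.2 ⟨?_, ?_⟩)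
  · refine (setLIntegral_mono' measurableSet_Ioc hb1).trans_lt ?_
    have : IntegrableOn (fun t : ℝ => M * t ^ (-α/2)) (Ioc 0 1) := by
      apply Integrable.const_mul
      have := intervalIntegral.intervalIntegrable_rpow' (a := 0) (b := 1) (r := -α/2) (by linarith)
      exact (intervalIntegrable_iff_integrableOn_Ioc_of_le zero_le_one).1 this
    exact this.lintegral_lt_top
  · refine (setLIntegral_mono' measurableSet_Ioi hb2).trans_lt ?_
    have : IntegrableOn (fun t : ℝ => M * t ^ (-α)) (Ioi 1) := by
      apply Integrable.const_mul
      exact integrableOn_Ioi_rpow_of_lt (by linarith) one_pos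
    exact this.lintegral_lt_top

theorem tail_le (h : LevyB μ α m M) {f : ℝ → ℝ} (hf : Integrable f μ)
    (h0 : ∀ y < 0, 0 ≤ f y) {x : ℝ} (hx : 0 < x) (h1 : ∀ y < -x, 1 ≤ f y) :
    m * x ^ (-α) ≤ ∫ y, f y ∂μ := by
  have hnn : 0 ≤ᵐ[μ] f := by filter_upwards [h.neg] with y hy using h0 y hy
  have key := mul_meas_ge_le_integral_of_nonneg hnn hf 1
  rw [one_mul] at key
  refine le_trans ?_ key
  have hfin : μ {x | 1 ≤ f x} < ⊤ := hf.measure_ge_lt_top one_pos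
  have : ENNReal.ofReal (m * x ^ (-α)) ≤ μ {x | 1 ≤ f x} :=
    (h.lo x hx).trans (measure_mono fun y hy => h1 y hy)
  exact (ENNReal.ofReal_le_iff_le_toReal hfin.ne).1 this

theorem integral_pos (h : LevyB μ α m M) {f : ℝ → ℝ} (hf : Integrable f μ)
    (h0 : ∀ y < 0, 0 < f y) : 0 < ∫ y, f y ∂μ := by
  have hnn : 0 ≤ᵐ[μ] f := by filter_upwards [h.neg] with y hy using (h0 y hy).le
  rw [integral_pos_iff_support_of_nonneg_ae hnn hf]
  have : Iio (-(1:ℝ)) ⊆ Function.support f := fun y hy => (h0 y (by have := mem_Iio.1 hy; linarith)).ne'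
  refine lt_of_lt_of_le ?_ (measure_mono this)
  refine lt_of_lt_of_le ?_ (h.lo 1 one_pos)
  simpa using h.hm

end LevyB

theorem norm_exp_aux1 {z : ℂ} (hz : z.re ≤ 0) : ‖Complex.exp z - 1‖ ≤ 2 * min 1 ‖z‖ := by
  rcases le_total ‖z‖ 1 with h | h
  · rw [min_eq_right h]; exact Complex.norm_exp_sub_one_le h
  · rw [min_eq_left h]
    have : ‖Complex.exp z‖ ≤ 1 := by rw [Complex.norm_exp]; exact Real.exp_le_one_iff.2 hz
    calc _ ≤ ‖Complex.exp z‖ + ‖(1:ℂ)‖ := norm_sub_le _ _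
      _ ≤ _ := by rw [norm_one]; linarith

theorem norm_exp_aux2 {z : ℂ} (hz : z.re ≤ 0) :
    ‖Complex.exp z - 1 - z‖ ≤ 3 * min ‖z‖ (‖z‖ ^ 2) := by
  rcases le_total ‖z‖ 1 with h | h
  · have := Complex.norm_exp_sub_one_sub_id_le h
    rw [min_eq_right (by nlinarith [norm_nonneg z])]
    nlinarith [norm_nonneg z, sq_nonneg ‖z‖]
  · rw [min_eq_left (by nlinarith [norm_nonneg z])]
    have h1 := norm_exp_aux1 hz
    rw [min_eq_left h] at h1
    calc _ ≤ ‖Complex.exp z - 1‖ + ‖z‖ := norm_sub_le _ _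
      _ ≤ _ := by linarith

theorem re_aux {w : ℂ} (hw : 0 ≤ w.re) {y : ℝ} (hy : y < 0) : (w * (y:ℂ)).re ≤ 0 := by
  simp only [Complex.re_mul_ofReal]
  exact mul_nonpos_of_nonneg_of_nonpos hw hy.le

theorem bound_F {w : ℂ} (hw : 0 ≤ w.re) {y : ℝ} (hy : y < 0) {K : ℝ} (hK : ‖w‖ ≤ K) :
    ‖Complex.exp (w * (y:ℂ)) - 1 - w * (y:ℂ)‖ ≤ 3 * (1 + K) ^ 2 * min |y| (y ^ 2) := by
  refine (norm_exp_aux2 (re_aux hw hy)).trans ?_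
  rw [mul_assoc]
  have hK0 : 0 ≤ K := (norm_nonneg w).trans hK
  have hn : ‖w * (y:ℂ)‖ = ‖w‖ * |y| := by simp
  rw [hn]
  gcongr
  rw [← sq_abs y]
  have hy0 := abs_nonneg y
  have hw0 := norm_nonneg w
  rcases le_total |y| (|y| ^ 2) with h | h
  · rw [min_eq_left h]
    refine (min_le_left _ _).trans ?_
    gcongr
    nlinarith
  · rw [min_eq_right h]
    refine (min_le_right _ _).trans ?_
    rw [mul_pow]
    gcongr
    linarith

theorem bound_F' {w : ℂ} (hw : 0 ≤ w.re) {y : ℝ} (hy : y < 0) {K : ℝ} (hK : ‖w‖ ≤ K) :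
    ‖(y:ℂ) * (Complex.exp (w * (y:ℂ)) - 1)‖ ≤ 2 * (1 + K) * min |y| (y ^ 2) := by
  rw [norm_mul, Complex.norm_real, Real.norm_eq_abs]
  have h1 := norm_exp_aux1 (re_aux hw hy)
  have hK0 : 0 ≤ K := (norm_nonneg w).trans hK
  have hn : ‖w * (y:ℂ)‖ = ‖w‖ * |y| := by simp
  rw [hn] at h1
  have hy0 := abs_nonneg y
  have hw0 := norm_nonneg w
  rw [← sq_abs y]
  refine (mul_le_mul_of_nonneg_left h1 hy0).trans ?_
  rcases le_total |y| (|y| ^ 2) with h | h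
  · rw [min_eq_left h]
    have := min_le_left 1 (‖w‖ * |y|)
    nlinarith
  · rw [min_eq_right h]
    have := min_le_right 1 (‖w‖ * |y|)
    have h3 : ‖w‖ * |y| ≤ (1 + K) * |y| := by gcongr; linarith
    nlinarith

noncomputable def PsiR (μ : Measure ℝ) (w : ℂ) : ℂ :=
  ∫ y : ℝ, (Complex.exp (w * (y:ℂ)) - 1 - w * (y:ℂ)) ∂μ

theorem exp_cos_aux {x y : ℝ} (hx : 0 ≤ x) (hy : |y| ≤ x / 2) :
    0 ≤ Real.exp (-x) * Real.cos y - 1 + x := by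
  have hE := Real.exp_pos (-x)
  have hE1 : Real.exp (-x) ≤ 1 := Real.exp_le_one_iff.2 (by linarith)
  rcases le_total x 2 with h | h
  · have h1 : 1 - x ^ 2 / 8 ≤ Real.cos y := by
      have := Real.one_sub_sq_div_two_le_cos (x := y)
      have h3 : y ^ 2 ≤ (x / 2) ^ 2 := sq_le_sq' (by linarith [neg_abs_le y]) (by linarith [le_abs_self y])
      nlinarith
    have h2 : (1 - x / 2) ^ 2 ≤ Real.exp (-x) := by
      have h4 : 1 - x / 2 ≤ Real.exp (-(x / 2)) := by
        have := Real.add_one_le_exp (-(x/2)); linarith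
      have : Real.exp (-x) = Real.exp (-(x / 2)) ^ 2 := by
        rw [← Real.exp_nat_mul]; congr 1; push_cast; ring
      rw [this]
      exact pow_le_pow_left₀ (by linarith) h4 2
    have h5 : 0 ≤ 1 - x ^ 2 / 8 := by nlinarith
    have h6 : (1 - x / 2) ^ 2 * (1 - x ^ 2 / 8) ≤ Real.exp (-x) * Real.cos y :=
      mul_le_mul h2 h1 h5 hE.le
    have h7 : 0 ≤ x ^ 2 * (4 + 4 * x - x ^ 2) := mul_nonneg (sq_nonneg _) (by nlinarith)
    nlinarith
  · have := Real.neg_one_le_cos y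
    nlinarith

namespace LevyB
variable {μ : Measure ℝ} {α m M : ℝ}

theorem intF (h : LevyB μ α m M) {w : ℂ} (hw : 0 ≤ w.re) :
    Integrable (fun y : ℝ => Complex.exp (w * (y:ℂ)) - 1 - w * (y:ℂ)) μ := by
  refine (h.integrable_min.const_mul (3 * (1 + ‖w‖) ^ 2)).mono'
    (by fun_prop) ?_
  filter_upwards [h.neg] with y hy using bound_F hw hy le_rfl

theorem intF' (h : LevyB μ α m M) {w : ℂ} (hw : 0 ≤ w.re) :
    Integrable (fun y : ℝ => (y:ℂ) * (Complex.exp (w * (y:ℂ)) - 1)) μ := by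
  refine (h.integrable_min.const_mul (2 * (1 + ‖w‖))).mono'
    (by fun_prop) ?_
  filter_upwards [h.neg] with y hy using bound_F' hw hy le_rfl

theorem continuousOn_Psi (h : LevyB μ α m M) : ContinuousOn (PsiR μ) {w | 0 ≤ w.re} := by
  intro w hw
  unfold PsiR
  have hev : ∀ᶠ x in nhdsWithin w {w | 0 ≤ w.re}, 0 ≤ x.re ∧ ‖x‖ ≤ ‖w‖ + 1 := by
    refine (eventually_mem_nhdsWithin).and (nhdsWithin_le_nhds ?_)
    have : ContinuousAt (fun x : ℂ => ‖x‖) w := by fun_prop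
    exact (this.eventually (gt_mem_nhds (lt_add_one _))).mono fun _ h => le_of_lt h
  refine continuousWithinAt_of_dominated
    (bound := fun y => 3 * (1 + (‖w‖ + 1)) ^ 2 * min |y| (y ^ 2)) ?_ ?_
    (h.integrable_min.const_mul _) ?_
  · exact Eventually.of_forall fun x => by fun_prop
  · filter_upwards [hev] with x hx
    filter_upwards [h.neg] with y hy using bound_F hx.1 hy hx.2
  · exact Eventually.of_forall fun y => by
      apply Continuous.continuousWithinAt; fun_prop

theorem hasDerivAt_Psi (h : LevyB μ α m M) {w : ℂ} (hw : 0 < w.re) :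
    HasDerivAt (PsiR μ) (∫ y : ℝ, (y:ℂ) * (Complex.exp (w * (y:ℂ)) - 1) ∂μ) w := by
  have hs : {x : ℂ | 0 < x.re ∧ ‖x‖ < ‖w‖ + 1} ∈ nhds w := by
    apply IsOpen.mem_nhds
    · exact (isOpen_lt continuous_const Complex.continuous_re).inter
        (isOpen_lt continuous_norm continuous_const)
    · exact ⟨hw, lt_add_one _⟩
  refine (hasDerivAt_integral_of_dominated_loc_of_deriv_le
    (F := fun w (y:ℝ) => Complex.exp (w * (y:ℂ)) - 1 - w * (y:ℂ))
    (F' := fun w (y:ℝ) => (y:ℂ) * (Complex.exp (w * (y:ℂ)) - 1))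
    (bound := fun y => 2 * (1 + (‖w‖ + 1)) * min |y| (y ^ 2)) hs ?_ (h.intF hw.le) ?_ ?_
    (h.integrable_min.const_mul _) ?_).2
  · exact Eventually.of_forall fun x => by fun_prop
  · fun_prop
  · filter_upwards [h.neg] with y hy x hx using bound_F' hx.1.le hy hx.2.le
  · refine Eventually.of_forall fun y x _ => ?_
    have h1 : HasDerivAt (fun x : ℂ => x * (y:ℂ)) (y:ℂ) x := by
      simpa using (hasDerivAt_id x).mul_const (y:ℂ)
    refine ((h1.cexp.sub_const 1).sub h1).congr_deriv ?_
    ring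

theorem re_Psi (h : LevyB μ α m M) {w : ℂ} (hw : 0 ≤ w.re) :
    Integrable (fun y : ℝ => Real.exp (w.re * y) * Real.cos (w.im * y) - 1 - w.re * y) μ ∧
    (PsiR μ w).re = ∫ y : ℝ, (Real.exp (w.re * y) * Real.cos (w.im * y) - 1 - w.re * y) ∂μ := by
  have e : (fun y : ℝ => Real.exp (w.re * y) * Real.cos (w.im * y) - 1 - w.re * y) =
      fun y : ℝ => Complex.reCLM (Complex.exp (w * (y:ℂ)) - 1 - w * (y:ℂ)) := by
    ext y; simp [Complex.exp_re]
  rw [e]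
  exact ⟨Complex.reCLM.integrable_comp (h.intF hw), (Complex.reCLM.integral_comp_comm (h.intF hw)).symm⟩

theorem im_Psi (h : LevyB μ α m M) {w : ℂ} (hw : 0 ≤ w.re) :
    Integrable (fun y : ℝ => Real.exp (w.re * y) * Real.sin (w.im * y) - w.im * y) μ ∧
    (PsiR μ w).im = ∫ y : ℝ, (Real.exp (w.re * y) * Real.sin (w.im * y) - w.im * y) ∂μ := by
  have e : (fun y : ℝ => Real.exp (w.re * y) * Real.sin (w.im * y) - w.im * y) =
      fun y : ℝ => Complex.imCLM (Complex.exp (w * (y:ℂ)) - 1 - w * (y:ℂ)) := by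
    ext y; simp [Complex.exp_im]
  rw [e]
  exact ⟨Complex.imCLM.integrable_comp (h.intF hw), (Complex.imCLM.integral_comp_comm (h.intF hw)).symm⟩

theorem im_lower_pos (h : LevyB μ α m M) {w : ℂ} (hw : 0 ≤ w.re) (hu : 0 < w.im) :
    m * (2 / w.im) ^ (-α) ≤ (PsiR μ w).im := by
  obtain ⟨hi, he⟩ := h.im_Psi hw
  rw [he]
  have key : ∀ y < 0, |Real.exp (w.re * y) * Real.sin (w.im * y)| ≤ |Real.sin (w.im * y)| := by
    intro y hy
    rw [abs_mul, abs_of_pos (Real.exp_pos _)]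
    have : Real.exp (w.re * y) ≤ 1 :=
      Real.exp_le_one_iff.2 (mul_nonpos_of_nonneg_of_nonpos hw hy.le)
    nlinarith [abs_nonneg (Real.sin (w.im * y))]
  refine h.tail_le hi ?_ (by positivity) ?_
  · intro y hy
    have h1 := key y hy
    have h2 := Real.abs_sin_le_abs (x := w.im * y)
    rw [abs_of_neg (mul_neg_of_pos_of_neg hu hy)] at h2
    have := neg_abs_le (Real.exp (w.re * y) * Real.sin (w.im * y))
    linarith
  · intro y hy
    have hy0 : y < 0 := hy.trans (by simp only [neg_neg_iff_pos]; positivity)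
    have h1 := key y hy0
    have h2 := Real.abs_sin_le_one (w.im * y)
    have := neg_abs_le (Real.exp (w.re * y) * Real.sin (w.im * y))
    have h3 : 2 < (-y) * w.im := (div_lt_iff₀ hu).1 (by linarith)
    linarith

theorem im_lower_neg (h : LevyB μ α m M) {w : ℂ} (hw : 0 ≤ w.re) (hu : w.im < 0) :
    m * (2 / (-w.im)) ^ (-α) ≤ -(PsiR μ w).im := by
  have := h.im_lower_pos (w := star w) (by simpa using hw) (by simpa using hu)
  have e : (PsiR μ (star w)).im = -(PsiR μ w).im := by
    rw [(h.im_Psi (w := star w) (by simpa using hw)).2, (h.im_Psi hw).2, ← integral_neg]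
    congr 1; ext y; simp; ring
  rw [e] at this
  simpa using this

theorem re_lower (h : LevyB μ α m M) {w : ℂ} (hw : 0 < w.re) (hu : |w.im| ≤ w.re / 2) :
    m * (3 / w.re) ^ (-α) ≤ (PsiR μ w).re := by
  obtain ⟨hi, he⟩ := h.re_Psi hw.le
  rw [he]
  refine h.tail_le hi ?_ (by positivity) ?_
  · intro y hy
    have := exp_cos_aux (x := -(w.re * y)) (y := w.im * y) (by nlinarith) (by
      rw [abs_mul, abs_of_neg hy]; nlinarith)
    rw [neg_neg] at this; linarith
  · intro y hy
    have hy0 : y < 0 := hy.trans (by simp only [neg_neg_iff_pos]; positivity)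
    have h3 : 3 < (-y) * w.re := (div_lt_iff₀ hw).1 (by linarith)
    have h1 : Real.exp (w.re * y) ≤ 1 :=
      Real.exp_le_one_iff.2 (mul_nonpos_of_nonneg_of_nonpos hw.le hy0.le)
    have := Real.neg_one_le_cos (w.im * y)
    nlinarith [Real.exp_pos (w.re * y)]

theorem norm_lower (h : LevyB μ α m M) {w : ℂ} (hw : 0 ≤ w.re) :
    m * (1 / 6) ^ α * ‖w‖ ^ α ≤ ‖PsiR μ w‖ := by
  have hα : 0 < α := by linarith [h.h1]
  have hm := h.hm
  have hn := Complex.norm_le_abs_re_add_abs_im w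
  rw [abs_of_nonneg hw] at hn
  have conv : ∀ a b : ℝ, 0 < a → 0 < b → ‖w‖ * b ≤ a * 6 →
      m * (1 / 6) ^ α * ‖w‖ ^ α ≤ m * (b / a) ^ (-α) := by
    intro a b ha hb hab
    rw [Real.rpow_neg (by positivity), ← Real.inv_rpow (by positivity), inv_div, mul_assoc,
      ← Real.mul_rpow (by norm_num) (norm_nonneg _)]
    gcongr
    rw [le_div_iff₀ hb]; linarith
  rcases le_or_gt |w.im| (w.re / 2) with hc | hc
  · rcases hw.eq_or_lt with h0 | h0
    · have : w.im = 0 := by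
        rw [← h0, zero_div] at hc; exact abs_nonpos_iff.1 hc
      have hw0 : w = 0 := Complex.ext h0.symm this
      rw [hw0]; simp [Real.zero_rpow hα.ne', PsiR]
    · exact (conv w.re 3 h0 (by norm_num) (by linarith)).trans ((h.re_lower h0 hc).trans
        ((le_abs_self _).trans (Complex.abs_re_le_norm _)))
  · rcases lt_trichotomy w.im 0 with h0 | h0 | h0
    · rw [abs_of_neg h0] at *
      exact (conv (-w.im) 2 (by linarith) (by norm_num) (by linarith)).trans ((h.im_lower_neg hw h0).trans
        ((neg_le_abs _).trans (Complex.abs_im_le_norm _)))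
    · rw [h0, abs_zero] at hc; linarith
    · rw [abs_of_pos h0] at *
      exact (conv (w.im) 2 (by linarith) (by norm_num) (by linarith)).trans ((h.im_lower_pos hw h0).trans
        ((le_abs_self _).trans (Complex.abs_im_le_norm _)))

theorem re_upper (h : LevyB μ α m M) :
    ∃ c : ℝ, 0 < c ∧ ∀ u : ℝ, (PsiR μ (Complex.I * u)).re ≤ - (c * |u| ^ α) := by
  have hα : 0 < α := by linarith [h.h1]
  have hm := h.hm
  have hM := h.hM
  obtain ⟨a, ha0, ha1, ha⟩ : ∃ a : ℝ, 0 < a ∧ a < 1 ∧ 2 * M ≤ m * a ^ (-α) := by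
    have ht : Tendsto (fun x : ℝ => x ^ α) atTop atTop := tendsto_rpow_atTop hα
    obtain ⟨x, hx1, hx2⟩ := ((ht.eventually_ge_atTop (2 * M / m)).and (eventually_gt_atTop 1)).exists
    refine ⟨x⁻¹, by positivity, inv_lt_one_of_one_lt₀ hx2, ?_⟩
    rw [Real.rpow_neg (by positivity), ← Real.inv_rpow (by positivity), inv_inv]
    rw [div_le_iff₀ hm] at hx1; linarith
  have hcosa : Real.cos a < 1 := by
    rw [← Real.cos_zero]
    exact Real.cos_lt_cos_of_nonneg_of_le_pi le_rfl (by linarith [Real.pi_gt_three]) ha0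
  refine ⟨(1 - Real.cos a) * M, mul_pos (by linarith) hM, fun u => ?_⟩
  rcases eq_or_ne u 0 with rfl | hu
  · simp [PsiR, Real.zero_rpow hα.ne']
  have hu' : 0 < |u| := abs_pos.2 hu
  obtain ⟨hi, he⟩ := h.re_Psi (w := Complex.I * u) (by simp)
  rw [he]
  simp only [Complex.mul_re, Complex.I_re, Complex.ofReal_re, Complex.I_im, Complex.ofReal_im,
    Complex.mul_im, zero_mul, mul_zero, sub_zero, Real.exp_zero, one_mul, zero_add] at hi ⊢
  have hi' : Integrable (fun y => 1 - Real.cos (u * y)) μ := by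
    convert hi.neg using 2
    simp
  have key := mul_meas_ge_le_integral_of_nonneg (Eventually.of_forall fun y => by
    simp [Real.cos_le_one]) hi' (1 - Real.cos a)
  have hS : Iio (-(a / |u|)) \ Iio (-(1 / |u|)) ⊆ {y | 1 - Real.cos a ≤ 1 - Real.cos (u * y)} := by
    rintro y ⟨h1, h2⟩
    simp only [mem_Iio, not_lt] at h1 h2
    have hy1 : a < (-y) * |u| := (div_lt_iff₀ hu').1 (by linarith)
    have hy2 : (-y) * |u| ≤ 1 := (le_div_iff₀ hu').1 (by linarith)
    have hyn : y < 0 := h1.trans (by simp only [neg_neg_iff_pos]; positivity)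
    have hab : |u * y| = (-y) * |u| := by rw [abs_mul, abs_of_neg hyn]; ring
    have : Real.cos (u * y) ≤ Real.cos a := by
      rw [← Real.cos_abs (u * y), hab]
      exact Real.cos_le_cos_of_nonneg_of_le_pi ha0.le (by linarith [Real.pi_gt_three]) hy1.le
    simp only [mem_ofPred_eq]; linarith
  have hfin : μ {y | 1 - Real.cos a ≤ 1 - Real.cos (u * y)} < ⊤ := hi'.measure_ge_lt_top (by linarith)
  have hmeas : M * |u| ^ α ≤ μ.real {y | 1 - Real.cos a ≤ 1 - Real.cos (u * y)} := by
    have hlo := h.lo (a / |u|) (by positivity)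
    have hhi := h.hi (1 / |u|) (by positivity)
    have e1 : (a / |u|) ^ (-α) = a ^ (-α) * |u| ^ α := by
      rw [Real.div_rpow ha0.le hu'.le, Real.rpow_neg hu'.le]; simp
    have e2 : (1 / |u|) ^ (-α) = |u| ^ α := by
      rw [Real.div_rpow zero_le_one hu'.le, Real.rpow_neg hu'.le]; simp
    rw [e1] at hlo
    rw [e2] at hhi
    refine (ENNReal.ofReal_le_iff_le_toReal hfin.ne).1 (le_trans ?_ (measure_mono hS))
    refine le_trans ?_ (le_measure_sdiff)
    refine le_trans ?_ (tsub_le_tsub hlo hhi)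
    rw [← ENNReal.ofReal_sub _ (by positivity)]
    apply ENNReal.ofReal_le_ofReal
    have := mul_le_mul_of_nonneg_right ha (Real.rpow_nonneg hu'.le α)
    linarith
  have e3 : ∫ y, (Real.cos (u * y) - 1) ∂μ = - ∫ y, (1 - Real.cos (u * y)) ∂μ := by
    rw [← integral_neg]; congr 1; ext y; ring
  rw [e3, neg_le_neg_iff]
  refine le_trans ?_ key
  rw [mul_assoc]
  exact mul_le_mul_of_nonneg_left hmeas (by linarith)

theorem re_strictMono (h : LevyB μ α m M) {a b : ℝ} (ha : 0 ≤ a) (hab : a < b) :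
    (PsiR μ a).re < (PsiR μ b).re := by
  obtain ⟨hi1, he1⟩ := h.re_Psi (w := (a:ℂ)) (by simpa using ha)
  obtain ⟨hi2, he2⟩ := h.re_Psi (w := (b:ℂ)) (by simpa using ha.trans hab.le)
  rw [he1, he2, ← sub_pos, ← integral_sub hi2 hi1]
  apply h.integral_pos (hi2.sub hi1)
  intro y hy
  simp only [Pi.sub_apply, Complex.ofReal_re, Complex.ofReal_im, zero_mul, Real.cos_zero, mul_one]
  have hd : b * y < a * y := mul_lt_mul_of_neg_right hab hy
  have h1 : b * y - a * y + 1 < Real.exp (b * y - a * y) := Real.add_one_lt_exp (by linarith)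
  have h2 : Real.exp (b * y) = Real.exp (a * y) * Real.exp (b * y - a * y) := by
    rw [← Real.exp_add]; congr 1; ring
  have h3 : Real.exp (a * y) ≤ 1 := Real.exp_le_one_iff.2 (mul_nonpos_of_nonneg_of_nonpos ha hy.le)
  have h4 := Real.exp_pos (a * y)
  have h5 := mul_lt_mul_of_pos_left h1 h4
  have h6 : 0 ≤ (1 - Real.exp (a * y)) * (a * y - b * y) := mul_nonneg (by linarith) (by linarith)
  nlinarith

theorem Psi_inj (h : LevyB μ α m M) {s ξ : ℝ} (hξ : 0 ≤ ξ) (hs : PsiR μ ξ = s) {w : ℂ}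
    (hw : 0 ≤ w.re) (hws : PsiR μ w = s) : w = ξ := by
  have hm := h.hm
  have him : w.im = 0 := by
    rcases lt_trichotomy w.im 0 with h0 | h0 | h0
    · have := h.im_lower_neg hw h0
      rw [hws] at this
      have h2 : 0 < m * (2 / -w.im) ^ (-α) :=
        mul_pos hm (Real.rpow_pos_of_pos (div_pos two_pos (by linarith)) _)
      simp at this; linarith
    · exact h0
    · have := h.im_lower_pos hw h0
      rw [hws] at this
      have h2 : 0 < m * (2 / w.im) ^ (-α) :=
        mul_pos hm (Real.rpow_pos_of_pos (div_pos two_pos (by linarith)) _)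
      simp at this; linarith
  have hwr : w = (w.re : ℂ) := Complex.ext (by simp) (by simp [him])
  rw [hwr] at hws ⊢
  rcases lt_trichotomy w.re ξ with h0 | h0 | h0
  · have := h.re_strictMono hw h0
    rw [hws, hs] at this; exact absurd this (lt_irrefl _)
  · rw [h0]
  · have := h.re_strictMono hξ h0
    rw [hws, hs] at this; exact absurd this (lt_irrefl _)

theorem deriv_pos (h : LevyB μ α m M) {ξ : ℝ} (hξ : 0 < ξ) :
    0 < ∫ y : ℝ, y * (Real.exp (ξ * y) - 1) ∂μ ∧
    (∫ y : ℝ, (y:ℂ) * (Complex.exp (ξ * (y:ℂ)) - 1) ∂μ) =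
      ((∫ y : ℝ, y * (Real.exp (ξ * y) - 1) ∂μ : ℝ) : ℂ) := by
  have hi := h.intF' (w := (ξ:ℂ)) (by simpa using hξ.le)
  have e : (fun y : ℝ => (y:ℂ) * (Complex.exp (ξ * (y:ℂ)) - 1)) =
      fun y : ℝ => ((y * (Real.exp (ξ * y) - 1) : ℝ) : ℂ) := by
    ext y; push_cast; rfl
  rw [e] at hi ⊢
  refine ⟨h.integral_pos ?_ ?_, integral_ofReal⟩
  · exact hi.re
  · intro y hy
    have : Real.exp (ξ * y) < 1 := by
      rw [← Real.exp_zero]; exact Real.exp_lt_exp.2 (mul_neg_of_pos_of_neg hξ hy)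
    exact mul_pos_of_neg_of_neg hy (by linarith)

end LevyB

theorem contour_aux (F : ℂ → ℂ) (ξ α C R0 : ℝ) (hα : 1 < α)
    (hc : ContinuousOn F {w | 0 ≤ w.re})
    (hd : ∀ w : ℂ, 0 < w.re → w ≠ ξ → DifferentiableAt ℂ F w)
    (hdec : ∀ w : ℂ, 0 ≤ w.re → R0 ≤ ‖w‖ → ‖F w‖ ≤ C * ‖w‖ ^ (-α))
    (hint : Integrable (fun u : ℝ => F (u * Complex.I))) :
    ∫ u : ℝ, F (u * Complex.I) = 0 := by
  have T1 : Tendsto (fun R : ℝ => ∫ u in (-R)..R, F (u * Complex.I)) atTop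
      (nhds (∫ u : ℝ, F (u * Complex.I))) :=
    intervalIntegral_tendsto_integral hint tendsto_neg_atTop_atBot tendsto_id
  have T2 : Tendsto (fun R : ℝ => ∫ u in (-R)..R, F (u * Complex.I)) atTop (nhds 0) := by
    have hz : Tendsto (fun R : ℝ => 4 * |C| * R ^ (-(α - 1))) atTop (nhds 0) := by
      simpa using (tendsto_rpow_neg_atTop (by linarith : 0 < α - 1)).const_mul (4 * |C|)
    refine squeeze_zero_norm' ?_ hz
    filter_upwards [eventually_ge_atTop R0, eventually_gt_atTop 0] with R hR hR0
    have key := Complex.integral_boundary_rect_eq_zero_of_differentiable_on_off_countable F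
      (⟨0, -R⟩ : ℂ) (⟨R, R⟩ : ℂ) {(ξ:ℂ)} (countable_singleton _) ?_ ?_
    · simp only [Complex.ofReal_zero, zero_add, smul_eq_mul] at key
      have hb : ∀ w : ℂ, 0 ≤ w.re → R ≤ ‖w‖ → ‖F w‖ ≤ |C| * R ^ (-α) := by
        intro w hw hRw
        refine (hdec w hw (hR.trans hRw)).trans ?_
        refine mul_le_mul (le_abs_self C) ?_ (by positivity) (abs_nonneg _)
        exact Real.rpow_le_rpow_of_nonpos hR0 hRw (by linarith)
      have b1 : ‖∫ x : ℝ in 0..R, F (x + ((-R : ℝ) : ℂ) * Complex.I)‖ ≤ |C| * R ^ (-α) * |R - 0| := by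
        apply intervalIntegral.norm_integral_le_of_norm_le_const
        intro x hx
        rw [uIoc_of_le hR0.le] at hx
        refine hb _ (by simpa using hx.1.le) ?_
        refine le_trans ?_ (Complex.abs_im_le_norm _)
        simp [abs_of_pos hR0]
      have b2 : ‖∫ x : ℝ in 0..R, F (x + (R : ℂ) * Complex.I)‖ ≤ |C| * R ^ (-α) * |R - 0| := by
        apply intervalIntegral.norm_integral_le_of_norm_le_const
        intro x hx
        rw [uIoc_of_le hR0.le] at hx
        refine hb _ (by simpa using hx.1.le) ?_
        refine le_trans ?_ (Complex.abs_im_le_norm _)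
        simp [abs_of_pos hR0]
      have b3 : ‖∫ y : ℝ in (-R)..R, F ((R:ℂ) + y * Complex.I)‖ ≤ |C| * R ^ (-α) * |R - (-R)| := by
        apply intervalIntegral.norm_integral_le_of_norm_le_const
        intro x hx
        refine hb _ (by simpa using hR0.le) ?_
        refine le_trans ?_ (Complex.abs_re_le_norm _)
        simp [abs_of_pos hR0]
      have e : Complex.I * (∫ u in (-R)..R, F (u * Complex.I)) =
          (∫ x : ℝ in 0..R, F (x + ((-R : ℝ) : ℂ) * Complex.I)) -
          (∫ x : ℝ in 0..R, F (x + (R : ℂ) * Complex.I)) +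
          Complex.I * ∫ y : ℝ in (-R)..R, F ((R:ℂ) + y * Complex.I) := by
        linear_combination -key
      have e2 : ‖∫ u in (-R)..R, F (u * Complex.I)‖ = ‖Complex.I * (∫ u in (-R)..R, F (u * Complex.I))‖ := by
        simp
      rw [e2, e]
      have eR : |R - 0| = R := by rw [sub_zero, abs_of_pos hR0]
      have eR2 : |R - -R| = 2 * R := by rw [sub_neg_eq_add, abs_of_pos (by linarith)]; ring
      rw [eR] at b1 b2
      rw [eR2] at b3
      have hpow : R ^ (-α) * R = R ^ (-(α - 1)) := by
        rw [← Real.rpow_add_one hR0.ne']; congr 1; ring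
      calc _ ≤ ‖∫ x : ℝ in 0..R, F (x + ((-R : ℝ) : ℂ) * Complex.I)‖ +
            ‖∫ x : ℝ in 0..R, F (x + (R : ℂ) * Complex.I)‖ +
            ‖Complex.I * ∫ y : ℝ in (-R)..R, F ((R:ℂ) + y * Complex.I)‖ :=
            (norm_add_le _ _).trans (by gcongr; exact norm_sub_le _ _)
        _ ≤ |C| * R ^ (-α) * R + |C| * R ^ (-α) * R + |C| * R ^ (-α) * (2 * R) := by
            rw [norm_mul, Complex.norm_I, one_mul]; gcongr
        _ = 4 * |C| * (R ^ (-α) * R) := by ring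
        _ = _ := by rw [hpow]
    · refine hc.mono ?_
      intro w hw
      have := hw.1
      simp only [mem_preimage, uIcc_of_le hR0.le] at this
      exact this.1
    · rintro w ⟨hw, hne⟩
      have := hw.1
      simp only [mem_preimage, min_eq_left hR0.le] at this
      exact hd w this.1 hne
  exact tendsto_nhds_unique T1 T2

theorem contour (G : ℂ → ℂ) (ξ α C R0 : ℝ) (hα : 1 < α) (hξ : 0 < ξ)
    (hc : ContinuousOn G ({w | 0 ≤ w.re} \ {(ξ:ℂ)}))
    (hd : ∀ w : ℂ, 0 < w.re → w ≠ ξ → DifferentiableAt ℂ G w)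
    (hres : Tendsto (fun w : ℂ => (w - ξ) * G w) (nhdsWithin (ξ:ℂ) {(ξ:ℂ)}ᶜ) (nhds 0))
    (hdec : ∀ w : ℂ, 0 ≤ w.re → R0 ≤ ‖w‖ → ‖G w‖ ≤ C * ‖w‖ ^ (-α))
    (x : ℝ) (hx : 0 < x)
    (hint : Integrable (fun u : ℝ => Complex.exp (-(x * (u * Complex.I))) * G (u * Complex.I))) :
    ∫ u : ℝ, Complex.exp (-(x * (u * Complex.I))) * G (u * Complex.I) = 0 := by
  have hopen : {w : ℂ | 0 < w.re} ∈ nhds (ξ:ℂ) :=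
    (isOpen_lt continuous_const Complex.continuous_re).mem_nhds (by simpa using hξ)
  have hlim := Complex.tendsto_limUnder_of_differentiable_on_punctured_nhds_of_isLittleO
    (f := G) (c := (ξ:ℂ)) ?_ ?_
  · set L := limUnder (nhdsWithin (ξ:ℂ) {(ξ:ℂ)}ᶜ) G
    set G1 : ℂ → ℂ := Function.update G ξ L with hG1
    have hne : ∀ w : ℂ, w ≠ ξ → G1 w = G w := fun w hw => Function.update_of_ne hw _ _
    have hnI : ∀ u : ℝ, (u * Complex.I : ℂ) ≠ ξ := by
      intro u hu
      have := congrArg Complex.re hu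
      simp at this; linarith
    have := contour_aux (fun w => Complex.exp (-(x * w)) * G1 w) ξ α C (max R0 (ξ + 1)) hα ?_ ?_ ?_ ?_
    · rw [← this]
      congr 1; ext u; simp only [hne _ (hnI u)]
    · intro w hw
      refine ContinuousWithinAt.mul (by apply Continuous.continuousWithinAt; fun_prop) ?_
      by_cases hwx : w = ξ
      · rw [hwx]
        exact (continuousAt_update_same.2 hlim).continuousWithinAt
      · have h1 := hc w ⟨hw, hwx⟩
        have h2 : ContinuousWithinAt G {w | 0 ≤ w.re} w := by
          refine h1.mono_of_mem_nhdsWithin ?_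
          filter_upwards [self_mem_nhdsWithin, nhdsWithin_le_nhds (isOpen_ne.mem_nhds hwx)] with z h3 h4
            using ⟨h3, h4⟩
        refine h2.congr_of_eventuallyEq ?_ (hne w hwx)
        refine nhdsWithin_le_nhds ?_
        filter_upwards [isOpen_ne.mem_nhds hwx] with z hz using hne z hz
    · intro w hw hwx
      refine DifferentiableAt.mul (by fun_prop) ?_
      refine (hd w hw hwx).congr_of_eventuallyEq ?_
      filter_upwards [isOpen_ne.mem_nhds hwx] with z hz using hne z hz
    · intro w hw hR
      have hR1 := (le_max_left _ _).trans hR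
      have hR2 := (le_max_right _ _).trans hR
      have hwx : w ≠ ξ := by
        rintro rfl
        rw [Complex.norm_real, Real.norm_eq_abs, abs_of_pos hξ] at hR2; linarith
      rw [hne w hwx, norm_mul]
      refine le_trans ?_ (hdec w hw hR1)
      refine mul_le_of_le_one_left (norm_nonneg _) ?_
      rw [Complex.norm_exp, Real.exp_le_one_iff]
      simp only [Complex.neg_re, Complex.re_ofReal_mul]
      have := mul_nonneg hx.le hw
      linarith
    · refine hint.congr (Eventually.of_forall fun u => ?_)
      simp only [hne _ (hnI u)]
  · filter_upwards [nhdsWithin_le_nhds hopen, self_mem_nhdsWithin] with w h1 h2 using hd w h1 h2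
  · rw [Asymptotics.isLittleO_iff_tendsto']
    · have h1 : Tendsto (fun w : ℂ => (w - ξ) * G ξ) (nhdsWithin (ξ:ℂ) {(ξ:ℂ)}ᶜ) (nhds 0) := by
        refine Tendsto.mono_left ?_ nhdsWithin_le_nhds
        have : Continuous (fun w : ℂ => (w - ξ) * G ξ) := by fun_prop
        simpa using this.tendsto (ξ:ℂ)
      have h2 := hres.sub h1
      rw [sub_zero] at h2
      refine h2.congr fun w => ?_
      rw [div_inv_eq_mul]; ring
    · filter_upwards [self_mem_nhdsWithin] with w hw h0
      exact absurd (sub_eq_zero.1 (inv_eq_zero.1 h0)) hw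

theorem inv_aux (f : ℝ → ℂ) (hc : Continuous f) (hf : Integrable f) (Φ : ℝ → ℂ)
    (hΦ : ∀ k : ℝ, ∫ x : ℝ, Complex.exp (Complex.I * k * x) * f x = Φ k)
    (hΦi : Integrable Φ) (x : ℝ) :
    ∫ k : ℝ, Complex.exp (-(x * (k * Complex.I))) * Φ k = 2 * Real.pi * f x := by
  have hpi := Real.pi_pos
  have h1 : (FourierTransform.fourier f : ℝ → ℂ) = fun w => Φ (-(2 * Real.pi) * w) := by
    ext w
    rw [Real.fourier_real_eq_integral_exp_smul, ← hΦ]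
    congr 1; ext v
    rw [smul_eq_mul]
    congr 2
    push_cast; ring
  have h2 : Integrable (FourierTransform.fourier f : ℝ → ℂ) := by
    rw [h1]
    exact hΦi.comp_mul_left' (by simp [hpi.ne'])
  have h3 := congrFun (hc.fourierInv_fourier_eq hf h2) x
  rw [Real.fourierInv_eq', h1] at h3
  have h4 := Measure.integral_comp_mul_left
    (fun k : ℝ => Complex.exp (-(x * (k * Complex.I))) * Φ k) (-(2 * Real.pi))
  have h5 : (fun v : ℝ => Complex.exp (((2 * Real.pi * inner ℝ v x : ℝ) : ℂ) * Complex.I) •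
      Φ (-(2 * Real.pi) * v)) = fun v : ℝ =>
      Complex.exp (-(x * (((-(2 * Real.pi) * v : ℝ) : ℂ) * Complex.I))) * Φ (-(2 * Real.pi) * v) := by
    ext v
    rw [smul_eq_mul]
    congr 2
    simp only [RCLike.inner_apply, conj_trivial]
    push_cast; ring
  rw [h5, h4] at h3
  rw [← h3]
  rw [abs_inv, abs_neg, abs_of_pos (by positivity), Complex.real_smul]
  push_cast
  have : (Real.pi : ℂ) ≠ 0 := by exact_mod_cast hpi.ne'
  rw [← mul_assoc, mul_inv_cancel₀ (by simpa using this), one_mul]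

theorem integrable_den {a b α : ℝ} (ha : 0 < a) (hb : 0 < b) (hα : 1 < α) :
    Integrable (fun k : ℝ => 1 / (a + b * |k| ^ α)) := by
  have h0 : Integrable (fun k : ℝ => (2 ^ α / min a b) * (1 + ‖k‖) ^ (-α)) :=
    (integrable_one_add_norm (by simpa using hα)).const_mul _
  have hα0 : 0 < α := by linarith
  have hcont : Continuous (fun k : ℝ => a + b * |k| ^ α) := by
    refine continuous_const.add (continuous_const.mul ?_)
    exact continuous_abs.rpow_const (fun _ => Or.inr hα0.le)
  have hpos : ∀ k : ℝ, 0 < a + b * |k| ^ α := fun k => by positivity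
  refine h0.mono' (Continuous.aestronglyMeasurable
    (continuous_const.div hcont fun k => (hpos k).ne')) (Eventually.of_forall fun k => ?_)
  have hmin : 0 < min a b := lt_min ha hb
  rw [Real.norm_eq_abs, abs_of_pos (by have := hpos k; positivity), Real.rpow_neg (by positivity),
    div_le_iff₀ (hpos k), Real.norm_eq_abs]
  have hk : 0 < (1 + |k|) ^ α := by positivity
  rw [div_mul_eq_mul_div, div_mul_eq_mul_div, le_div_iff₀ hmin, one_mul, mul_assoc,
    ← div_eq_inv_mul, ← mul_div_assoc, le_div_iff₀ hk]
  have h1 : (1 + |k|) ^ α ≤ 2 ^ α * (1 + |k| ^ α) := by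
    rcases le_total |k| 1 with h | h
    · calc (1 + |k|) ^ α ≤ 2 ^ α := by gcongr; linarith
        _ ≤ _ := by
          have : 0 ≤ |k| ^ α := by positivity
          have : (0:ℝ) < 2 ^ α := by positivity
          nlinarith
    · calc (1 + |k|) ^ α ≤ (2 * |k|) ^ α := by gcongr; linarith
        _ = 2 ^ α * |k| ^ α := Real.mul_rpow (by norm_num) (abs_nonneg _)
        _ ≤ _ := by gcongr; linarith
  have h2 : min a b * (1 + |k| ^ α) ≤ a + b * |k| ^ α := by
    have := min_le_left a b
    have h4 : min a b * |k| ^ α ≤ b * |k| ^ α := by gcongr; exact min_le_right _ _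
    linarith
  calc min a b * (1 + |k|) ^ α ≤ min a b * (2 ^ α * (1 + |k| ^ α)) := by gcongr
    _ = 2 ^ α * (min a b * (1 + |k| ^ α)) := by ring
    _ ≤ _ := by gcongr

theorem cauchy_int {ξ : ℝ} (hξ : 0 < ξ) :
    Integrable (fun u : ℝ => (2 * ξ : ℂ) / (ξ ^ 2 + u ^ 2)) := by
  have h := (integrable_den (a := ξ ^ 2) (b := 1) (α := 2) (by positivity) one_pos (by norm_num)).const_mul (2 * ξ)
  have := h.ofReal (𝕜 := ℂ)
  refine this.congr (Eventually.of_forall fun u => ?_)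
  simp [mul_one_div]
  simp only [← Complex.ofReal_pow, sq_abs, div_eq_mul_inv]

theorem cauchy_ft {ξ : ℝ} (hξ : 0 < ξ) {x : ℝ} (hx : 0 < x) :
    ∫ u : ℝ, Complex.exp (-(x * (u * Complex.I))) * ((2 * ξ : ℂ) / (ξ ^ 2 + u ^ 2)) =
      2 * Real.pi * (Real.exp (-(x * ξ)) : ℝ) := by
  have e1 : ∀ k : ℝ, ∀ y ∈ Iic (0:ℝ), Complex.exp (Complex.I * k * y) * ((Real.exp (-(ξ * |y|)) : ℝ) : ℂ) =
      Complex.exp ((ξ + Complex.I * k) * y) := by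
    intro k y hy
    rw [abs_of_nonpos hy]; push_cast; rw [← Complex.exp_add]; congr 1; ring
  have e2 : ∀ k : ℝ, ∀ y ∈ Ioi (0:ℝ), Complex.exp (Complex.I * k * y) * ((Real.exp (-(ξ * |y|)) : ℝ) : ℂ) =
      Complex.exp ((-ξ + Complex.I * k) * y) := by
    intro k y hy
    rw [abs_of_pos hy]; push_cast; rw [← Complex.exp_add]; congr 1; ring
  have i1 : ∀ k : ℝ, IntegrableOn (fun y : ℝ => Complex.exp (Complex.I * k * y) * ((Real.exp (-(ξ * |y|)) : ℝ) : ℂ)) (Iic 0) := by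
    intro k
    rw [integrableOn_congr_fun (e1 k) measurableSet_Iic]
    exact integrableOn_exp_mul_complex_Iic (by simpa using hξ) 0
  have i2 : ∀ k : ℝ, IntegrableOn (fun y : ℝ => Complex.exp (Complex.I * k * y) * ((Real.exp (-(ξ * |y|)) : ℝ) : ℂ)) (Ioi 0) := by
    intro k
    rw [integrableOn_congr_fun (e2 k) measurableSet_Ioi]
    exact integrableOn_exp_mul_complex_Ioi (by simpa using hξ) 0
  have := inv_aux (fun y => ((Real.exp (-(ξ * |y|)) : ℝ) : ℂ)) (by fun_prop) ?_
    (fun u => (2 * ξ : ℂ) / (ξ ^ 2 + u ^ 2)) ?_ (cauchy_int hξ) x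
  · rw [this, abs_of_pos hx, mul_comm ξ x]
  · rw [← integrableOn_univ, ← Iic_union_Ioi (a := (0:ℝ))]
    have := (i1 0).union (i2 0)
    simpa using this
  · intro k
    rw [← setIntegral_univ, ← Iic_union_Ioi (a := (0:ℝ)), setIntegral_union (Iic_disjoint_Ioi le_rfl)
      measurableSet_Ioi (i1 k) (i2 k), setIntegral_congr_fun measurableSet_Iic (e1 k),
      setIntegral_congr_fun measurableSet_Ioi (e2 k),
      integral_exp_mul_complex_Iic (by simpa using hξ),
      integral_exp_mul_complex_Ioi (by simpa using hξ)]
    have n1 : (ξ + Complex.I * k : ℂ) ≠ 0 := by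
      intro h; have := congrArg Complex.re h; simp at this; linarith
    have n2 : (-ξ + Complex.I * k : ℂ) ≠ 0 := by
      intro h; have := congrArg Complex.re h; simp at this; linarith
    have e3 : (ξ ^ 2 + k ^ 2 : ℂ) = -((ξ + Complex.I * k) * (-ξ + Complex.I * k)) := by
      linear_combination ((k:ℂ) ^ 2) * Complex.I_sq
    rw [e3]
    simp only [Complex.ofReal_zero, mul_zero, Complex.exp_zero]
    field_simp
    ring

namespace LevyB
variable {μ : Measure ℝ} {α m M : ℝ}

theorem cont_line (h : LevyB μ α m M) : Continuous (fun k : ℝ => PsiR μ (Complex.I * k)) :=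
  h.continuousOn_Psi.comp_continuous (by fun_prop) (by simp)

theorem int_exp (h : LevyB μ α m M) {t : ℝ} (ht : 0 < t) :
    Integrable (fun k : ℝ => Complex.exp (t * PsiR μ (Complex.I * k))) := by
  obtain ⟨c, hc, hre⟩ := h.re_upper
  have := h.cont_line
  refine (integrable_den one_pos (mul_pos ht hc) h.h1).mono'
    (Continuous.aestronglyMeasurable (by fun_prop)) (Eventually.of_forall fun k => ?_)
  rw [Complex.norm_exp, Complex.re_ofReal_mul]
  have h1 : t * (PsiR μ (Complex.I * k)).re ≤ -(t * c * |k| ^ α) := by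
    have := mul_le_mul_of_nonneg_left (hre k) ht.le
    linarith
  have h2 : 0 < 1 + t * c * |k| ^ α := by positivity
  calc _ ≤ Real.exp (-(t * c * |k| ^ α)) := Real.exp_le_exp.2 h1
    _ = 1 / Real.exp (t * c * |k| ^ α) := by rw [Real.exp_neg, one_div]
    _ ≤ _ := by
      apply one_div_le_one_div_of_le h2
      have := Real.add_one_le_exp (t * c * |k| ^ α); linarith

theorem swap (h : LevyB μ α m M) {s : ℝ} (hs : 0 < s) (x : ℝ) :
    ∫ t in Ioi (0:ℝ), Complex.exp (-(s * t)) *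
      (∫ k : ℝ, Complex.exp (-(x * (k * Complex.I))) * Complex.exp (t * PsiR μ (Complex.I * k))) =
    ∫ k : ℝ, Complex.exp (-(x * (k * Complex.I))) * (1 / (s - PsiR μ (Complex.I * k))) := by
  obtain ⟨c, hc, hre⟩ := h.re_upper
  have hcl := h.cont_line
  simp_rw [← integral_const_mul]
  have hneg : ∀ k : ℝ, (PsiR μ (Complex.I * k) - s).re < 0 := by
    intro k
    have := hre k
    have : 0 ≤ c * |k| ^ α := by positivity
    simp; linarith
  have e : ∀ t k : ℝ, Complex.exp (-(s * t)) * (Complex.exp (-(x * (k * Complex.I))) *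
      Complex.exp (t * PsiR μ (Complex.I * k))) =
      Complex.exp (-(x * (k * Complex.I))) * Complex.exp ((PsiR μ (Complex.I * k) - s) * t) := by
    intro t k
    simp only [← Complex.exp_add]; congr 1; ring
  have n1 : ∀ k : ℝ, ‖Complex.exp (-(x * (k * Complex.I)))‖ = 1 := by
    intro k; rw [Complex.norm_exp]; simp
  rw [integral_integral_swap]
  · congr 1; ext k
    simp_rw [e]
    rw [integral_const_mul, integral_exp_mul_complex_Ioi (hneg k)]
    congr 1
    simp only [Complex.ofReal_zero, mul_zero, Complex.exp_zero]
    rw [← neg_sub, div_neg, neg_div, neg_neg]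
  · have hm : AEStronglyMeasurable (Function.uncurry fun t k : ℝ => Complex.exp (-(s * t)) *
      (Complex.exp (-(x * (k * Complex.I))) * Complex.exp (t * PsiR μ (Complex.I * k))))
      ((volume.restrict (Ioi 0)).prod volume) := by
      apply Continuous.aestronglyMeasurable
      have : Continuous (fun q : ℝ × ℝ => PsiR μ (Complex.I * q.2)) := hcl.comp continuous_snd
      unfold Function.uncurry
      fun_prop
    rw [integrable_prod_iff' hm]
    constructor
    · refine Eventually.of_forall fun k => ?_
      simp only [Function.uncurry_apply_pair, e]
      exact (integrableOn_exp_mul_complex_Ioi (hneg k) 0).const_mul _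
    · simp only [Function.uncurry_apply_pair, e, norm_mul, n1, one_mul, Complex.norm_exp,
        Complex.re_mul_ofReal]
      have e4 : (fun k : ℝ => ∫ t in Ioi (0:ℝ), Real.exp ((PsiR μ (Complex.I * k) - s).re * t)) =
          fun k : ℝ => 1 / (s - (PsiR μ (Complex.I * k)).re) := by
        ext k
        rw [integral_exp_mul_Ioi (hneg k)]
        simp only [mul_zero, Real.exp_zero, Complex.sub_re, Complex.ofReal_re]
        rw [← neg_sub s, div_neg, neg_div, neg_neg]
      rw [e4]
      have hb : ∀ k : ℝ, s + c * |k| ^ α ≤ s - (PsiR μ (Complex.I * k)).re := fun k => by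
        linarith [hre k]
      have hp : ∀ k : ℝ, 0 < s + c * |k| ^ α := fun k => by positivity
      refine (integrable_den hs hc h.h1).mono' (Continuous.aestronglyMeasurable ?_)
        (Eventually.of_forall fun k => ?_)
      · refine continuous_const.div (by fun_prop) fun k => ((hp k).trans_le (hb k)).ne'
      · have := (hp k).trans_le (hb k)
        rw [Real.norm_eq_abs, abs_of_pos (by positivity)]
        exact one_div_le_one_div_of_le (hp k) (hb k)

theorem int_main (h : LevyB μ α m M) {s : ℝ} (hs : 0 < s) (x : ℝ) :
    Integrable (fun k : ℝ => Complex.exp (-(x * (k * Complex.I))) * (1 / (s - PsiR μ (k * Complex.I)))) := by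
  obtain ⟨c, hc, hre⟩ := h.re_upper
  have hcl := h.cont_line
  simp_rw [mul_comm _ Complex.I] at *
  have hb : ∀ k : ℝ, s + c * |k| ^ α ≤ ‖s - PsiR μ (Complex.I * k)‖ := fun k => by
    refine le_trans ?_ ((le_abs_self _).trans (Complex.abs_re_le_norm _))
    simp only [Complex.sub_re, Complex.ofReal_re]
    linarith [hre k]
  have hp : ∀ k : ℝ, 0 < s + c * |k| ^ α := fun k => by positivity
  refine (integrable_den hs hc h.h1).mono' (Continuous.aestronglyMeasurable ?_)
    (Eventually.of_forall fun k => ?_)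
  · refine Continuous.mul (by fun_prop) (continuous_const.div (by fun_prop) fun k => ?_)
    exact norm_pos_iff.1 ((hp k).trans_le (hb k))
  · rw [norm_mul, Complex.norm_exp, norm_div, norm_one]
    simp only [Complex.neg_re, Complex.re_ofReal_mul, Complex.mul_re, Complex.I_re, Complex.I_im,
      Complex.ofReal_im, zero_mul, mul_zero, sub_zero, neg_zero, Real.exp_zero, one_mul]
    exact one_div_le_one_div_of_le (hp k) (hb k)

theorem contour_main (h : LevyB μ α m M) {s ξ x : ℝ} (hs : 0 < s) (hξ : 0 < ξ) (hx : 0 < x)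
    (hξs : PsiR μ ξ = s) :
    ∫ k : ℝ, Complex.exp (-(x * (k * Complex.I))) * (1 / (s - PsiR μ (Complex.I * k))) =
      2 * Real.pi * ((Real.exp (-(x * ξ)) / (∫ y : ℝ, y * (Real.exp (ξ * y) - 1) ∂μ) : ℝ) : ℂ) := by
  obtain ⟨hD, hDe⟩ := h.deriv_pos hξ
  have hder := h.hasDerivAt_Psi (w := (ξ:ℂ)) (by simpa using hξ)
  rw [hDe] at hder
  set D : ℝ := ∫ y : ℝ, y * (Real.exp (ξ * y) - 1) ∂μ
  have hα := h.h1
  have hDC : (D : ℂ) ≠ 0 := by exact_mod_cast hD.ne'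
  have hne1 : ∀ w : ℂ, 0 ≤ w.re → w ≠ ξ → (s:ℂ) - PsiR μ w ≠ 0 := by
    intro w hw hwx h0
    exact hwx (h.Psi_inj hξ.le hξs hw (sub_eq_zero.1 h0).symm)
  have hne3 : ∀ w : ℂ, 0 ≤ w.re → w + ξ ≠ 0 := by
    intro w hw h0
    have := congrArg Complex.re h0
    simp at this; linarith
  have hne2 : ∀ w : ℂ, 0 ≤ w.re → w ≠ ξ → (ξ:ℂ) ^ 2 - w ^ 2 ≠ 0 := by
    intro w hw hwx h0
    have : (ξ - w) * (w + ξ) = 0 := by linear_combination h0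
    rcases mul_eq_zero.1 this with h1 | h1
    · exact hwx (sub_eq_zero.1 h1).symm
    · exact hne3 w hw h1
  set c : ℝ := m * (1 / 6) ^ α with hcdef
  have hc : 0 < c := mul_pos h.hm (by positivity)
  obtain ⟨R0, hR0⟩ : ∃ R0 : ℝ, ∀ r ≥ R0, s ≤ c / 2 * r ^ α ∧ 2 * ξ ^ 2 ≤ r ^ 2 ∧ 1 ≤ r := by
    apply eventually_atTop.1
    refine Eventually.and ?_ (Eventually.and ?_ (eventually_ge_atTop 1))
    · exact ((tendsto_rpow_atTop (by linarith)).const_mul_atTop (by positivity)).eventually_ge_atTop _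
    · exact (tendsto_pow_atTop two_ne_zero).eventually_ge_atTop _
  set G : ℂ → ℂ := fun w => 1 / (s - PsiR μ w) - 1 / D * ((2 * ξ) / (ξ ^ 2 - w ^ 2)) with hG
  have eI : ∀ u : ℝ, (ξ:ℂ) ^ 2 - (u * Complex.I) ^ 2 = ξ ^ 2 + u ^ 2 := by
    intro u; linear_combination (-(u:ℂ) ^ 2) * Complex.I_sq
  have hi1 := h.int_main hs x
  have hi2 : Integrable (fun u : ℝ => Complex.exp (-(x * (u * Complex.I))) *
      ((2 * ξ : ℂ) / (ξ ^ 2 + u ^ 2))) := by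
    refine (cauchy_int hξ).bdd_mul (c := 1) (Continuous.aestronglyMeasurable (by fun_prop))
      (Eventually.of_forall fun u => ?_)
    rw [Complex.norm_exp]; simp
  have eG : ∀ u : ℝ, Complex.exp (-(x * (u * Complex.I))) * G (u * Complex.I) =
      Complex.exp (-(x * (u * Complex.I))) * (1 / (s - PsiR μ (u * Complex.I))) -
      1 / D * (Complex.exp (-(x * (u * Complex.I))) * ((2 * ξ : ℂ) / (ξ ^ 2 + u ^ 2))) := by
    intro u
    simp only [hG, eI]; ring
  have key := contour G ξ α (2 / c + 4 * ξ / D) R0 hα hξ ?_ ?_ ?_ ?_ x hx ?_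
  · simp_rw [eG] at key
    rw [integral_sub hi1 (hi2.const_mul _), integral_const_mul, cauchy_ft hξ hx, sub_eq_zero] at key
    simp_rw [mul_comm _ Complex.I] at key ⊢
    rw [key]
    push_cast
    ring
  · intro w hw
    have h1 : ContinuousWithinAt (PsiR μ) ({w | 0 ≤ w.re} \ {(ξ:ℂ)}) w :=
      (h.continuousOn_Psi w hw.1).mono sdiff_subset
    refine ContinuousWithinAt.sub (continuousWithinAt_const.div (continuousWithinAt_const.sub h1)
      (hne1 w hw.1 hw.2)) (continuousWithinAt_const.mul (continuousWithinAt_const.div ?_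
      (hne2 w hw.1 hw.2)))
    apply Continuous.continuousWithinAt; fun_prop
  · intro w hw hwx
    have h1 : DifferentiableAt ℂ (PsiR μ) w := (h.hasDerivAt_Psi hw).differentiableAt
    have h2 := hne1 w hw.le hwx
    have h3 := hne2 w hw.le hwx
    simp only [hG]
    fun_prop (disch := assumption)
  · have hsl := hder.tendsto_slope
    have hinv : Tendsto (fun w : ℂ => (slope (PsiR μ) (ξ:ℂ) w)⁻¹) (nhdsWithin (ξ:ℂ) {(ξ:ℂ)}ᶜ)
        (nhds ((D:ℂ)⁻¹)) := hsl.inv₀ hDC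
    have hξ2 : (ξ:ℂ) + ξ ≠ 0 := hne3 ξ (by simpa using hξ.le)
    have h2 : Tendsto (fun w : ℂ => 1 / (D:ℂ) * (2 * ξ / (w + ξ))) (nhdsWithin (ξ:ℂ) {(ξ:ℂ)}ᶜ)
        (nhds (1 / (D:ℂ) * (2 * ξ / (ξ + ξ)))) := by
      refine Tendsto.mono_left ?_ nhdsWithin_le_nhds
      have : ContinuousAt (fun w : ℂ => 1 / (D:ℂ) * (2 * ξ / (w + ξ))) ξ := by
        fun_prop (disch := assumption)
      exact this
    have h3 := h2.sub hinv
    have e0 : 1 / (D:ℂ) * (2 * ξ / (ξ + ξ)) - (D:ℂ)⁻¹ = 0 := by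
      rw [← two_mul] at hξ2 ⊢
      rw [div_self hξ2]; simp
    rw [e0] at h3
    refine h3.congr' ?_
    have hopen : {w : ℂ | 0 < w.re} ∈ nhds (ξ:ℂ) :=
      (isOpen_lt continuous_const Complex.continuous_re).mem_nhds (by simpa using hξ)
    filter_upwards [nhdsWithin_le_nhds hopen, self_mem_nhdsWithin] with w h4 h5
    have h4' : 0 ≤ w.re := le_of_lt h4
    have h6 := hne1 w h4' h5
    have h7 := hne3 w h4'
    have h8 : w - ξ ≠ 0 := sub_ne_zero.2 h5
    have e5 : (ξ:ℂ) ^ 2 - w ^ 2 = -((w - ξ) * (w + ξ)) := by ring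
    have e6 : PsiR μ w - s ≠ 0 := by rw [← neg_sub]; exact neg_ne_zero.2 h6
    have e7 : (s:ℂ) - PsiR μ w = -(PsiR μ w - s) := by ring
    simp only [hG, e5, slope_def_field, hξs]
    rw [e7]
    field_simp
    ring
  · intro w hw hR
    obtain ⟨r1, r2, r3⟩ := hR0 _ hR
    have hw0 : 0 < ‖w‖ := by linarith
    have hpos : 0 < ‖w‖ ^ α := by positivity
    have hl := h.norm_lower hw
    rw [← hcdef] at hl
    have b1 : c / 2 * ‖w‖ ^ α ≤ ‖(s:ℂ) - PsiR μ w‖ := by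
      have := norm_sub_norm_le (PsiR μ w) (s:ℂ)
      rw [norm_sub_rev, Complex.norm_real, Real.norm_eq_abs, abs_of_pos hs] at this
      linarith
    have b2 : ‖w‖ ^ 2 / 2 ≤ ‖(ξ:ℂ) ^ 2 - w ^ 2‖ := by
      have := norm_sub_norm_le (w ^ 2) ((ξ:ℂ) ^ 2)
      rw [norm_sub_rev, norm_pow, norm_pow, Complex.norm_real, Real.norm_eq_abs, sq_abs] at this
      linarith
    have b3 : ‖w‖ ^ α ≤ ‖w‖ ^ 2 := by
      rw [← Real.rpow_natCast]
      exact Real.rpow_le_rpow_of_exponent_le r3 (by have := h.h2; push_cast; linarith)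
    have c1 : ‖1 / ((s:ℂ) - PsiR μ w)‖ ≤ 2 / c * ‖w‖ ^ (-α) := by
      rw [norm_div, norm_one]
      refine (one_div_le_one_div_of_le (by positivity) b1).trans (le_of_eq ?_)
      rw [Real.rpow_neg hw0.le]; field_simp
    have c2 : ‖1 / (D:ℂ) * ((2 * ξ) / (ξ ^ 2 - w ^ 2))‖ ≤ 4 * ξ / D * ‖w‖ ^ (-α) := by
      rw [norm_mul, norm_div, norm_div, norm_one, Complex.norm_real, norm_mul, Complex.norm_real,
        Real.norm_eq_abs, Real.norm_eq_abs, abs_of_pos hD, abs_of_pos hξ, Complex.norm_ofNat]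
      have b4 : ‖w‖ ^ α / 2 ≤ ‖(ξ:ℂ) ^ 2 - w ^ 2‖ := by linarith
      calc 1 / D * (2 * ξ / ‖(ξ:ℂ) ^ 2 - w ^ 2‖) ≤ 1 / D * (2 * ξ / (‖w‖ ^ α / 2)) := by gcongr
        _ = _ := by rw [Real.rpow_neg hw0.le]; field_simp; ring
    calc ‖G w‖ ≤ _ := norm_sub_le _ _
      _ ≤ _ := by rw [add_mul]; exact add_le_add c1 c2
  · simp_rw [eG]
    exact hi1.sub (hi2.const_mul _)

end LevyB

theorem levyB_of (α c : ℝ) (hα : 1 < α ∧ α < 2) (hc : 1 < c)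
    (θ : ℝ → ℝ) (hθc : Continuous θ) (hθpos : ∀ y : ℝ, 0 < θ y)
    (hθper : Function.Periodic θ (Real.log (c ^ (1 / α))))
    (φm : MeasureTheory.Measure ℝ)
    (hφtail : ∀ x : ℝ, 0 < x → φm (Set.Iio (-x)) = ENNReal.ofReal (x ^ (-α) * θ (Real.log x))) :
    ∃ m M : ℝ, LevyB (φm.restrict (Set.Iio 0)) α m M := by
  have hT : Real.log (c ^ (1 / α)) ≠ 0 := by
    have : 1 < c ^ (1 / α) := Real.one_lt_rpow hc (by have := hα.1; positivity)
    exact (Real.log_pos this).ne'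
  have hcomp := hθper.compact_of_continuous hT hθc
  obtain ⟨a, ha⟩ := hcomp.exists_isLeast (range_nonempty θ)
  obtain ⟨b, hb⟩ := hcomp.exists_isGreatest (range_nonempty θ)
  have ha0 : 0 < a := by obtain ⟨y, rfl⟩ := ha.1; exact hθpos y
  have hb0 : 0 < b := by obtain ⟨y, rfl⟩ := hb.1; exact hθpos y
  have hr : ∀ x : ℝ, 0 < x → φm.restrict (Set.Iio 0) (Iio (-x)) =
      ENNReal.ofReal (x ^ (-α) * θ (Real.log x)) := by
    intro x hx
    rw [Measure.restrict_apply measurableSet_Iio, Iio_inter_Iio, min_eq_left (by linarith),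
      hφtail x hx]
  refine ⟨a, b, hα.1, hα.2, ha0, hb0, ae_restrict_mem measurableSet_Iio, ?_, ?_⟩
  · intro x hx
    rw [hr x hx]
    apply ENNReal.ofReal_le_ofReal
    rw [mul_comm]
    gcongr
    exact ha.2 (mem_range_self _)
  · intro x hx
    rw [hr x hx]
    apply ENNReal.ofReal_le_ofReal
    rw [mul_comm]
    gcongr
    exact hb.2 (mem_range_self _)

theorem psiSemi_eq (φm : MeasureTheory.Measure ℝ) (z : ℂ) :
    psiSemi φm z = PsiR (φm.restrict (Set.Iio 0)) (Complex.I * z) := rfl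

/-- Theorem 3.1: the Laplace transform in time of the negatively skewed
semistable density is `exp(-x ξ(s)) / s'(ξ(s))`, where `ξ` inverts `k ↦ ψ(-ik)` and
`s'(k) = ∫ y (e^{ky} - 1) dφ(y)`. -/
theorem laplace_transform_semistable_density
    (α c : ℝ) (hα : 1 < α ∧ α < 2) (hc : 1 < c)
    (θ : ℝ → ℝ) (hθc : Continuous θ) (hθpos : ∀ y : ℝ, 0 < θ y)
    (hθper : Function.Periodic θ (Real.log (c ^ (1 / α))))
    (hθmono : AntitoneOn (fun x : ℝ => x ^ (-α) * θ (Real.log x)) (Set.Ioi 0))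
    (φm : MeasureTheory.Measure ℝ)
    (hφtail : ∀ x : ℝ, 0 < x → φm (Set.Iio (-x)) = ENNReal.ofReal (x ^ (-α) * θ (Real.log x)))
    (hφsupp : φm (Set.Ici 0) = 0)
    (ξ : ℝ → ℝ)
    (hξ : ∀ s : ℝ, 0 < s → 0 < ξ s ∧ psiSemi φm (-(Complex.I * (ξ s : ℂ))) = (s : ℂ))
    (p : ℝ → ℝ → ℝ)
    (hp_cont : ContinuousOn (fun q : ℝ × ℝ => p q.1 q.2) (Set.univ ×ˢ Set.Ioi 0))
    (hp_nonneg : ∀ x t : ℝ, 0 ≤ p x t)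
    (hp_int : ∀ t : ℝ, 0 < t → MeasureTheory.Integrable (fun x => p x t))
    (hp_ft : ∀ t : ℝ, 0 < t → ∀ k : ℝ,
      (∫ x : ℝ, Complex.exp (Complex.I * (k : ℂ) * (x : ℂ)) * ((p x t : ℝ) : ℂ))
        = Complex.exp ((t : ℂ) * psiSemi φm (k : ℂ))) :
    ∀ x s : ℝ, 0 < x → 0 < s →
      ∫ t in Set.Ioi (0 : ℝ), Real.exp (-(s * t)) * p x t
        = Real.exp (-(x * ξ s)) /
            (∫ y in Set.Iio (0 : ℝ), y * (Real.exp (ξ s * y) - 1) ∂φm) := by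
  intro x s hx hs
  obtain ⟨m, M, h⟩ := levyB_of α c hα hc θ hθc hθpos hθper φm hφtail
  obtain ⟨hξ0, hξs⟩ := hξ s hs
  rw [psiSemi_eq] at hξs
  have e0 : Complex.I * -(Complex.I * (ξ s : ℂ)) = ξ s := by
    linear_combination (-(ξ s : ℂ)) * Complex.I_sq
  rw [e0] at hξs
  have h1 := h.contour_main hs hξ0 hx hξs
  rw [← h.swap hs x] at h1
  have hpi : (2 * Real.pi : ℂ) ≠ 0 := by
    simp [Real.pi_ne_zero]
  have h2 : ∀ t ∈ Set.Ioi (0:ℝ), Complex.exp (-(s * t)) * (∫ k : ℝ, Complex.exp (-(x * (k * Complex.I))) *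
      Complex.exp (t * PsiR (φm.restrict (Set.Iio 0)) (Complex.I * k))) =
      2 * Real.pi * ((Real.exp (-(s * t)) * p x t : ℝ) : ℂ) := by
    intro t ht
    have hcont : Continuous (fun y : ℝ => p y t) :=
      hp_cont.comp_continuous (f := fun y : ℝ => (y, t)) (by fun_prop) (fun y => ⟨mem_univ _, ht⟩)
    have := inv_aux (fun y => ((p y t : ℝ) : ℂ)) (by fun_prop) (hp_int t ht).ofReal
      (fun k => Complex.exp (t * PsiR (φm.restrict (Set.Iio 0)) (Complex.I * k)))
      (fun k => hp_ft t ht k) (h.int_exp ht) x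
    rw [this]
    push_cast
    ring
  rw [setIntegral_congr_fun measurableSet_Ioi h2, integral_const_mul, integral_complex_ofReal] at h1
  have h3 := mul_left_cancel₀ hpi h1
  exact_mod_cast h3
end

section
/- Let α ∈ (1,2), c > 1, θ admissible, φ the measure on (−∞,0) with φ((−∞,−x)) = x^{−α}θ(log x), ψ(z) = ∫_{(−∞,0)} (e^{izx} − 1 − izx) dφ(x), and for s > 0 let ξ(s) > 0 be the unique positive real with ψ(−i·ξ(s)) = s. Then for all x > 0, s > 0 and any ξ₀ with 0 < ξ₀ < ξ(s), the shifted-contour Fourier inversion integral satisfies: (1/(2π))·lim_{T→∞} ∫_{−T}^{T} exp(−i(u − iξ₀)x) / (s − ψ(u − iξ₀)) du = exp(−x·ξ(s)) / s'(ξ(s)), where s'(k) = ∫_{(−∞,0)} y·(e^{ky} − 1) dφ(y). -/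
open MeasureTheory Set Filter

/-- Two-sided power bounds of the tail. -/
lemma semi_tail_bounds (α c : ℝ) (hα : 1 < α) (hc : 1 < c)
    (θ : ℝ → ℝ) (hθc : Continuous θ) (hθpos : ∀ y : ℝ, 0 < θ y)
    (hθper : Function.Periodic θ (Real.log (c ^ (1 / α)))) :
    ∃ A B : ℝ, 0 < A ∧ 0 < B ∧ ∀ y, A ≤ θ y ∧ θ y ≤ B := by
  have hp : 0 < Real.log (c ^ (1 / α)) := by
    apply Real.log_pos
    exact Real.one_lt_rpow hc (by positivity)
  have hK : IsCompact (Icc 0 (Real.log (c ^ (1 / α)))) := isCompact_Icc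
  have hne : (Icc 0 (Real.log (c ^ (1 / α)))).Nonempty := ⟨0, left_mem_Icc.2 hp.le⟩
  obtain ⟨a, ha, hA⟩ := hK.exists_isMinOn hne hθc.continuousOn
  obtain ⟨b, hb, hB⟩ := hK.exists_isMaxOn hne hθc.continuousOn
  refine ⟨θ a, θ b, hθpos a, hθpos b, fun y => ?_⟩
  obtain ⟨y', hy', h⟩ := hθper.exists_mem_Ico₀ hp y
  rw [h]
  exact ⟨hA (Ico_subset_Icc_self hy'), hB (Ico_subset_Icc_self hy')⟩

/-- Integrability of `min (x²) |x|`. -/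
lemma semi_integrable_min (α : ℝ) (h1 : 1 < α) (h2 : α < 2) (φm : Measure ℝ) (B : ℝ)
    (hB : ∀ t : ℝ, 0 < t → φm (Iio (-t)) ≤ ENNReal.ofReal (B * t ^ (-α))) :
    Integrable (fun x : ℝ => min (x ^ 2) |x|) (φm.restrict (Iio 0)) := by
  have hcont : Continuous (fun x : ℝ => min (x ^ 2) |x|) := by fun_prop
  have hnn : ∀ x : ℝ, 0 ≤ min (x ^ 2) |x| := fun x => le_min (sq_nonneg x) (abs_nonneg x)
  refine ⟨hcont.aestronglyMeasurable, ?_⟩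
  rw [hasFiniteIntegral_iff_ofReal (Eventually.of_forall hnn)]
  rw [lintegral_eq_lintegral_meas_lt _ (Eventually.of_forall hnn) hcont.aemeasurable]
  have hbd : ∀ t : ℝ, 0 < t → ∀ r : ℝ, 0 < r → (∀ x : ℝ, x < 0 → t < min (x ^ 2) |x| → r < -x) →
      (φm.restrict (Iio 0)) {a | t < min (a ^ 2) |a|} ≤ ENNReal.ofReal (B * r ^ (-α)) := by
    intro t ht r hr h
    rw [Measure.restrict_apply' measurableSet_Iio]
    refine (measure_mono ?_).trans (hB r hr)
    rintro x ⟨hx, hx0⟩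
    have := h x hx0 hx
    simp only [mem_Iio]; linarith
  have hsplit : Ioi (0 : ℝ) = Ioc 0 1 ∪ Ioi 1 := by
    rw [Ioc_union_Ioi_eq_Ioi zero_le_one]
  rw [hsplit]
  refine (lintegral_union_le _ _ _).trans_lt ?_
  rw [ENNReal.add_lt_top]
  constructor
  · have hi : IntegrableOn (fun t : ℝ => B * t ^ (-(α / 2))) (Ioc 0 1) := by
      apply Integrable.const_mul
      have := intervalIntegral.intervalIntegrable_rpow' (a := 0) (b := 1) (r := -(α/2)) (by linarith)
      exact (intervalIntegrable_iff_integrableOn_Ioc_of_le zero_le_one).1 this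
    refine lt_of_le_of_lt ?_ hi.lintegral_lt_top
    refine setLIntegral_mono' measurableSet_Ioc fun t ht => ?_
    refine (hbd t ht.1 (Real.sqrt t) (Real.sqrt_pos.2 ht.1) ?_).trans_eq ?_
    · intro x hx hm
      rw [Real.sqrt_lt' (by linarith)]
      have := lt_min_iff.1 hm
      linarith [this.1, neg_sq x]
    · rw [Real.sqrt_eq_rpow, ← Real.rpow_mul ht.1.le]
      congr 3; ring
  · have hi : IntegrableOn (fun t : ℝ => B * t ^ (-α)) (Ioi 1) := by
      apply Integrable.const_mul
      exact integrableOn_Ioi_rpow_of_lt (by linarith) one_pos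
    refine lt_of_le_of_lt ?_ hi.lintegral_lt_top
    refine setLIntegral_mono' measurableSet_Ioi fun t ht => ?_
    have ht' : (0:ℝ) < t := lt_trans one_pos ht
    refine (hbd t ht' t ht' ?_)
    intro x hx hm
    have := lt_min_iff.1 hm
    rw [abs_of_neg hx] at this
    exact this.2

lemma norm_exp_sub_one_le_of_re (w : ℂ) (hw : w.re ≤ 0) :
    ‖Complex.exp w - 1‖ ≤ 2 ∧ ‖Complex.exp w - 1‖ ≤ 2 * ‖w‖ := by
  have h2 : ‖Complex.exp w - 1‖ ≤ 2 := by
    refine (norm_sub_le _ _).trans ?_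
    rw [Complex.norm_exp, norm_one]
    have := Real.exp_le_one_iff.2 hw
    linarith
  refine ⟨h2, ?_⟩
  rcases le_total ‖w‖ 1 with h | h
  · exact Complex.norm_exp_sub_one_le h
  · linarith

lemma norm_exp_sub_le_of_re (w : ℂ) (hw : w.re ≤ 0) :
    ‖Complex.exp w - 1 - w‖ ≤ 3 * ‖w‖ ∧ ‖Complex.exp w - 1 - w‖ ≤ 3 * ‖w‖ ^ 2 := by
  have h0 := norm_nonneg w
  have hA : ‖Complex.exp w - 1 - w‖ ≤ 3 * ‖w‖ := by
    refine (norm_sub_le _ _).trans ?_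
    have := (norm_exp_sub_one_le_of_re w hw).2
    linarith
  refine ⟨hA, ?_⟩
  rcases le_total ‖w‖ 1 with h | h
  · have := Complex.norm_exp_sub_one_sub_id_le h
    nlinarith
  · nlinarith

lemma re_Izx (z : ℂ) (x : ℝ) : (Complex.I * z * x).re = -z.im * x := by simp
lemma im_Izx (z : ℂ) (x : ℝ) : (Complex.I * z * x).im = z.re * x := by simp
lemma norm_Izx (z : ℂ) (x : ℝ) : ‖Complex.I * z * x‖ = ‖z‖ * |x| := by simp

lemma semi_bound (z : ℂ) (hz : z.im ≤ 0) (x : ℝ) (hx : x < 0) :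
    ‖Complex.exp (Complex.I * z * x) - 1 - Complex.I * z * x‖
      ≤ 3 * (‖z‖ + ‖z‖ ^ 2) * min (x ^ 2) |x| := by
  have hre : (Complex.I * z * x).re ≤ 0 := by rw [re_Izx]; nlinarith
  have h := norm_exp_sub_le_of_re _ hre
  rw [norm_Izx] at h
  have h0 := norm_nonneg z
  have hx0 := abs_nonneg x
  rcases min_choice (x ^ 2) |x| with hm | hm <;> rw [hm]
  · have := h.2
    rw [mul_pow, sq_abs] at this
    nlinarith [sq_nonneg x, mul_nonneg h0 (sq_nonneg x)]
  · nlinarith [h.1, mul_nonneg (sq_nonneg ‖z‖) hx0]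

lemma semi_bound' (z : ℂ) (hz : z.im ≤ 0) (x : ℝ) (hx : x < 0) :
    ‖Complex.I * x * (Complex.exp (Complex.I * z * x) - 1)‖
      ≤ 2 * (1 + ‖z‖) * min (x ^ 2) |x| := by
  have hre : (Complex.I * z * x).re ≤ 0 := by rw [re_Izx]; nlinarith
  have h := norm_exp_sub_one_le_of_re _ hre
  rw [norm_Izx] at h
  have h0 := norm_nonneg z
  have hx0 := abs_nonneg x
  rw [norm_mul, norm_mul, Complex.norm_I, one_mul, Complex.norm_real, Real.norm_eq_abs]
  rcases min_choice (x ^ 2) |x| with hm | hm <;> rw [hm]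
  · have := mul_le_mul_of_nonneg_left h.2 hx0
    nlinarith [sq_abs x, sq_nonneg x]
  · have := mul_le_mul_of_nonneg_left h.1 hx0
    nlinarith [mul_nonneg h0 hx0]

section
variable {φm : Measure ℝ}

lemma semi_integrable (hm : Integrable (fun x : ℝ => min (x ^ 2) |x|) (φm.restrict (Iio 0)))
    (z : ℂ) (hz : z.im ≤ 0) :
    Integrable (fun x : ℝ => Complex.exp (Complex.I * z * (x : ℂ)) - 1 - Complex.I * z * (x : ℂ))
      (φm.restrict (Iio 0)) := by
  refine (hm.const_mul (3 * (‖z‖ + ‖z‖ ^ 2))).mono' ?_ ?_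
  · exact Continuous.aestronglyMeasurable (by fun_prop)
  · filter_upwards [ae_restrict_mem measurableSet_Iio] with x hx
    exact semi_bound z hz x hx

lemma semi_integrable' (hm : Integrable (fun x : ℝ => min (x ^ 2) |x|) (φm.restrict (Iio 0)))
    (z : ℂ) (hz : z.im ≤ 0) :
    Integrable (fun x : ℝ => Complex.I * x * (Complex.exp (Complex.I * z * (x : ℂ)) - 1))
      (φm.restrict (Iio 0)) := by
  refine (hm.const_mul (2 * (1 + ‖z‖))).mono' ?_ ?_
  · exact Continuous.aestronglyMeasurable (by fun_prop)
  · filter_upwards [ae_restrict_mem measurableSet_Iio] with x hx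
    exact semi_bound' z hz x hx

lemma semi_hasDerivAt (hm : Integrable (fun x : ℝ => min (x ^ 2) |x|) (φm.restrict (Iio 0)))
    (z : ℂ) (hz : z.im < 0) :
    HasDerivAt (psiSemi φm)
      (∫ x in Iio (0:ℝ), Complex.I * x * (Complex.exp (Complex.I * z * (x : ℂ)) - 1) ∂φm) z := by
  have hopen : IsOpen {w : ℂ | w.im < 0} := isOpen_lt Complex.continuous_im continuous_const
  have hS : {w : ℂ | w.im < 0} ∩ Metric.ball z 1 ∈ nhds z :=
    inter_mem (hopen.mem_nhds hz) (Metric.ball_mem_nhds z one_pos)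
  refine (hasDerivAt_integral_of_dominated_loc_of_deriv_le
    (F := fun (w : ℂ) (x : ℝ) => Complex.exp (Complex.I * w * (x : ℂ)) - 1 - Complex.I * w * (x : ℂ))
    (F' := fun (w : ℂ) (x : ℝ) =>
      Complex.I * x * (Complex.exp (Complex.I * w * (x : ℂ)) - 1))
    (bound := fun x => 2 * (1 + (‖z‖ + 1)) * min (x ^ 2) |x|)
    hS ?_ (semi_integrable hm z hz.le) ?_ ?_ (hm.const_mul _) ?_).2
  · exact Eventually.of_forall fun w => Continuous.aestronglyMeasurable (by fun_prop)
  · exact Continuous.aestronglyMeasurable (by fun_prop)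
  · filter_upwards [ae_restrict_mem measurableSet_Iio] with x hx w hw
    refine (semi_bound' w (le_of_lt hw.1) x hx).trans ?_
    have : ‖w‖ ≤ ‖z‖ + 1 := by
      have h1 := hw.2
      rw [Metric.mem_ball, dist_eq_norm] at h1
      have := norm_sub_norm_le w z
      linarith
    have h0 : 0 ≤ min (x ^ 2) |x| := le_min (sq_nonneg x) (abs_nonneg x)
    gcongr
  · refine Eventually.of_forall fun x w hw => ?_
    have h1 : HasDerivAt (fun w : ℂ => Complex.I * w * (x : ℂ)) (Complex.I * x) w := by
      simpa using ((hasDerivAt_id w).const_mul Complex.I).mul_const (x : ℂ)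
    have h2 := (h1.cexp.sub_const 1).sub h1
    refine h2.congr_deriv ?_
    ring

lemma semi_pos_of_pos {f : ℝ → ℝ} (hf : Integrable f (φm.restrict (Iio 0)))
    (hpos : ∀ x < 0, 0 < f x) (hφ : 0 < φm (Iio 0)) : 0 < ∫ x in Iio (0:ℝ), f x ∂φm := by
  rw [setIntegral_pos_iff_support_of_nonneg_ae _ hf]
  · refine hφ.trans_le (measure_mono fun x hx => ⟨(hpos x hx).ne', hx⟩)
  · filter_upwards [ae_restrict_mem measurableSet_Iio] with x hx
    exact (hpos x hx).le

lemma psi_re (hm : Integrable (fun x : ℝ => min (x ^ 2) |x|) (φm.restrict (Iio 0)))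
    (z : ℂ) (hz : z.im ≤ 0) :
    Integrable (fun x : ℝ => Real.exp (-z.im * x) * Real.cos (z.re * x) - 1 + z.im * x)
      (φm.restrict (Iio 0)) ∧
    (psiSemi φm z).re =
      ∫ x in Iio (0:ℝ), (Real.exp (-z.im * x) * Real.cos (z.re * x) - 1 + z.im * x) ∂φm := by
  have hi := semi_integrable hm z hz
  have heq : ∀ x : ℝ,
    (Complex.exp (Complex.I * z * (x : ℂ)) - 1 - Complex.I * z * (x : ℂ)).re
      = Real.exp (-z.im * x) * Real.cos (z.re * x) - 1 + z.im * x := by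
    intro x
    rw [Complex.sub_re, Complex.sub_re, Complex.exp_re, re_Izx, im_Izx, Complex.one_re]; ring
  constructor
  · refine hi.re.congr (Eventually.of_forall heq)
  · unfold psiSemi
    have := integral_re hi
    simp only [RCLike.re_to_complex] at this
    rw [← this]
    exact integral_congr_ae (Eventually.of_forall heq)

lemma psi_im (hm : Integrable (fun x : ℝ => min (x ^ 2) |x|) (φm.restrict (Iio 0)))
    (z : ℂ) (hz : z.im ≤ 0) :
    Integrable (fun x : ℝ => Real.exp (-z.im * x) * Real.sin (z.re * x) - z.re * x)
      (φm.restrict (Iio 0)) ∧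
    (psiSemi φm z).im =
      ∫ x in Iio (0:ℝ), (Real.exp (-z.im * x) * Real.sin (z.re * x) - z.re * x) ∂φm := by
  have hi := semi_integrable hm z hz
  have heq : ∀ x : ℝ,
    (Complex.exp (Complex.I * z * (x : ℂ)) - 1 - Complex.I * z * (x : ℂ)).im
      = Real.exp (-z.im * x) * Real.sin (z.re * x) - z.re * x := by
    intro x
    rw [Complex.sub_im, Complex.sub_im, Complex.exp_im, re_Izx, im_Izx, Complex.one_im]; ring
  constructor
  · refine hi.im.congr (Eventually.of_forall heq)
  · unfold psiSemi
    have := integral_im hi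
    simp only [RCLike.im_to_complex] at this
    rw [← this]
    exact integral_congr_ae (Eventually.of_forall heq)

/-- Pointwise inequality behind the imaginary part bound. -/
lemma im_aux (q v : ℝ) (hq : 0 ≤ q) (hq1 : q ≤ 1) (hv : 0 ≤ v) :
    0 ≤ v - q * Real.sin v ∧ (2 ≤ v → 1 ≤ v - q * Real.sin v) := by
  have h1 := Real.sin_le hv
  have h2 := Real.sin_le_one v
  constructor
  · rcases le_total 0 (Real.sin v) with h | h <;> nlinarith
  · intro _
    rcases le_total 0 (Real.sin v) with h | h <;> nlinarith

/-- Lower bound of the imaginary part. -/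
lemma psi_im_lower (hm : Integrable (fun x : ℝ => min (x ^ 2) |x|) (φm.restrict (Iio 0)))
    (α A : ℝ)
    (hAt : ∀ t : ℝ, 0 < t → ENNReal.ofReal (A * t ^ (-α)) ≤ φm (Iio (-t)))
    (z : ℂ) (hz : z.im ≤ 0) (hre : z.re ≠ 0) :
    A * (2 / |z.re|) ^ (-α) ≤ |(psiSemi φm z).im| := by
  obtain ⟨hi, he⟩ := psi_im hm z hz
  set u := |z.re| with hu
  have hupos : 0 < u := abs_pos.2 hre
  -- the integrand with `u` in place of the signed real part
  set f : ℝ → ℝ := fun x => u * (-x) - Real.exp (-z.im * x) * Real.sin (u * (-x)) with hf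
  have hif : Integrable f (φm.restrict (Iio 0)) ∧
      |(psiSemi φm z).im| = |∫ x in Iio (0:ℝ), f x ∂φm| := by
    rcases abs_choice z.re with h | h
    · have hff : f = fun x : ℝ => Real.exp (-z.im * x) * Real.sin (z.re * x) - z.re * x := by
        funext x
        simp only [hf, hu, h, mul_neg, Real.sin_neg]; ring
      rw [hff, he]; exact ⟨hi, rfl⟩
    · have hff : f = fun x : ℝ => -(Real.exp (-z.im * x) * Real.sin (z.re * x) - z.re * x) := by
        funext x
        simp only [hf, hu, h, neg_mul_neg]; ring
      rw [hff, he, integral_neg, abs_neg]; exact ⟨hi.neg, rfl⟩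
  obtain ⟨hfi, hfe⟩ := hif
  have hq : ∀ x : ℝ, x < 0 → Real.exp (-z.im * x) ≤ 1 := fun x hx =>
    Real.exp_le_one_iff.2 (by nlinarith)
  have hnn : ∀ x : ℝ, x < 0 → 0 ≤ f x := fun x hx =>
    (im_aux _ _ (Real.exp_pos _).le (hq x hx) (by nlinarith)).1
  rw [hfe]
  refine le_trans ?_ (le_abs_self _)
  have ht : 0 < 2 / u := by positivity
  have hsub : Iio (-(2 / u)) ⊆ Iio (0:ℝ) := Iio_subset_Iio (by linarith)
  have hfin : φm (Iio (-(2 / u))) ≠ ⊤ := by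
    have h1 : (φm.restrict (Iio 0)) {x | 1 ≤ f x} < ⊤ := hfi.measure_ge_lt_top one_pos
    refine ne_of_lt (lt_of_le_of_lt ?_ h1)
    rw [Measure.restrict_apply' measurableSet_Iio]
    refine measure_mono fun x hx => ⟨?_, hsub hx⟩
    refine (im_aux _ _ (Real.exp_pos _).le (hq x (hsub hx)) ?_).2 ?_
    · nlinarith [show x < 0 from hsub hx]
    · have hx' : x < -(2 / u) := hx
      have : u * (2 / u) = 2 := by field_simp
      nlinarith
  calc A * (2 / u) ^ (-α) ≤ (φm (Iio (-(2 / u)))).toReal :=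
        (ENNReal.ofReal_le_iff_le_toReal hfin).1 (hAt _ ht)
    _ = ∫ x in Iio (-(2 / u)), (1:ℝ) ∂φm := by simp [Measure.real]
    _ ≤ ∫ x in Iio (-(2 / u)), f x ∂φm := by
        refine setIntegral_mono_on ?_ ?_ measurableSet_Iio ?_
        · exact integrableOn_const hfin
        · exact IntegrableOn.mono_set hfi hsub
        · intro x hx
          refine (im_aux _ _ (Real.exp_pos _).le (hq x (hsub hx)) ?_).2 ?_
          · nlinarith [show x < 0 from hsub hx]
          · have hx' : x < -(2 / u) := hx
            have : u * (2 / u) = 2 := by field_simp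
            nlinarith
    _ ≤ ∫ x in Iio (0:ℝ), f x ∂φm := by
        refine setIntegral_mono_set hfi ?_ hsub.eventuallyLE
        filter_upwards [ae_restrict_mem measurableSet_Iio] with x hx
        exact hnn x hx

/-- The real part is large deep in the half plane, near the imaginary axis. -/
lemma psi_re_lower (hm : Integrable (fun x : ℝ => min (x ^ 2) |x|) (φm.restrict (Iio 0)))
    (hφ : 0 < φm (Iio (-1))) (M : ℝ) :
    ∃ k₀ : ℝ, 0 < k₀ ∧ ∀ z : ℂ, z.im ≤ -k₀ → |z.re| ≤ 1 → M ≤ (psiSemi φm z).re := by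
  have hsub : Iio (-1) ⊆ Iio (0:ℝ) := Iio_subset_Iio (by norm_num)
  have hfin : φm (Iio (-1)) ≠ ⊤ := by
    have h1 : (φm.restrict (Iio 0)) {x : ℝ | 1 ≤ min (x ^ 2) |x|} < ⊤ :=
      hm.measure_ge_lt_top one_pos
    refine ne_of_lt (lt_of_le_of_lt ?_ h1)
    rw [Measure.restrict_apply' measurableSet_Iio]
    refine measure_mono fun x hx => ⟨?_, hsub hx⟩
    have hx' : x < -1 := hx
    change 1 ≤ min (x ^ 2) |x|
    refine le_min (by nlinarith) ?_
    rw [abs_of_neg (by linarith)]; linarith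
  set P := (φm (Iio (-1))).toReal with hP
  have hPpos : 0 < P := ENNReal.toReal_pos hφ.ne' hfin
  set J := ∫ x in Iio (0:ℝ), min (x ^ 2) |x| ∂φm with hJ
  refine ⟨max 1 ((|M| + J) / P + 2), by positivity, fun z hz hre => ?_⟩
  have hk1 : 1 ≤ -z.im := by linarith [le_max_left 1 ((|M| + J) / P + 2)]
  have hk2 : (|M| + J) / P + 2 ≤ -z.im := by linarith [le_max_right 1 ((|M| + J) / P + 2)]
  obtain ⟨hi, he⟩ := psi_re hm z (by linarith)
  rw [he]
  have hind : Integrable ((Iio (-1:ℝ)).indicator fun _ => (-z.im - 2)) (φm.restrict (Iio 0)) := by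
    rw [integrable_indicator_iff measurableSet_Iio]
    refine integrableOn_const ?_
    rw [Measure.restrict_apply' measurableSet_Iio, inter_eq_left.2 hsub]
    exact hfin
  have hle : ∫ x in Iio (0:ℝ), ((Iio (-1:ℝ)).indicator (fun _ => (-z.im - 2)) x - min (x ^ 2) |x|) ∂φm
      ≤ ∫ x in Iio (0:ℝ), (Real.exp (-z.im * x) * Real.cos (z.re * x) - 1 + z.im * x) ∂φm := by
    refine setIntegral_mono_on (hind.sub hm) hi measurableSet_Iio fun x hx => ?_
    have hx0 : x < 0 := hx
    have hq : Real.exp (-z.im * x) ≤ 1 := Real.exp_le_one_iff.2 (by nlinarith)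
    have hq0 := Real.exp_pos (-z.im * x)
    have hmin : 0 ≤ min (x ^ 2) |x| := le_min (sq_nonneg x) (abs_nonneg x)
    have hq2 := Real.add_one_le_exp (-z.im * x)
    by_cases hx1 : x < -1
    · rw [indicator_of_mem (by exact hx1)]
      have := Real.neg_one_le_cos (z.re * x)
      nlinarith
    · rw [indicator_of_notMem (by exact hx1)]
      have hx1' : -1 ≤ x := not_lt.1 hx1
      have hmm : min (x ^ 2) |x| = x ^ 2 := by
        apply min_eq_left
        rw [abs_of_neg hx0]; nlinarith
      rw [hmm]
      have hc := Real.one_sub_sq_div_two_le_cos (x := z.re * x)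
      have hc' : 1 - Real.cos (z.re * x) ≤ x ^ 2 := by
        have h2 : z.re ^ 2 ≤ 1 := by rw [← sq_abs]; nlinarith [abs_nonneg z.re]
        nlinarith [sq_nonneg x, mul_pow z.re x 2]
      have hc0 : 0 ≤ 1 - Real.cos (z.re * x) := by linarith [Real.cos_le_one (z.re * x)]
      nlinarith
  refine le_trans ?_ hle
  rw [integral_sub hind hm, integral_indicator measurableSet_Iio,
    Measure.restrict_restrict measurableSet_Iio, inter_eq_left.2 hsub, setIntegral_const]
  simp only [Measure.real, smul_eq_mul, ← hP, ← hJ]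
  have : (|M| + J) / P ≤ -z.im - 2 := by linarith
  rw [div_le_iff₀ hPpos] at this
  linarith [le_abs_self M]

end

/-- Contour lemma: the integral over the top side tends to zero. -/
lemma contour_top_tendsto (H : ℂ → ℂ) (ξ₀ : ℝ) (S B : ℝ → ℝ)
    (hH : DifferentiableOn ℂ H {z | z.im ≤ -ξ₀})
    (hS : ∀ᶠ T : ℝ in atTop, ∀ z : ℂ, z.im ≤ -ξ₀ → |z.re| = T → ‖H z‖ ≤ S T)
    (hB : ∀ᶠ T : ℝ in atTop, ∀ z : ℂ, z.im = -(ξ₀ + T) → ‖H z‖ ≤ B T)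
    (hS0 : Tendsto (fun T => T * S T) atTop (nhds 0))
    (hB0 : Tendsto (fun T => T * B T) atTop (nhds 0)) :
    Tendsto (fun T : ℝ => ∫ u in (-T)..T, H (u - Complex.I * ξ₀)) atTop (nhds 0) := by
  have hlim : Tendsto (fun T => 2 * (T * B T) + 2 * (T * S T)) atTop (nhds 0) := by
    simpa using (hB0.const_mul 2).add (hS0.const_mul 2)
  refine squeeze_zero_norm' ?_ hlim
  filter_upwards [hS, hB, eventually_gt_atTop 0] with T h1 h2 hT
  have hrect := Complex.integral_boundary_rect_eq_zero_of_differentiableOn H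
    (⟨-T, -(ξ₀ + T)⟩ : ℂ) (⟨T, -ξ₀⟩ : ℂ) (hH.mono ?_)
  · simp only at hrect
    have e1 : ‖∫ u in (-T)..T, H (u + ((-(ξ₀ + T) : ℝ) : ℂ) * Complex.I)‖ ≤ B T * |T - -T| := by
      refine intervalIntegral.norm_integral_le_of_norm_le_const fun u _ => ?_
      exact h2 _ (by simp)
    have hu : ∀ y : ℝ, y ∈ uIoc (-(ξ₀ + T)) (-ξ₀) → y ≤ -ξ₀ := by
      intro y hy
      rw [uIoc_of_le (by linarith)] at hy
      exact hy.2
    have e2 : ‖∫ y in (-(ξ₀ + T))..(-ξ₀), H ((T : ℂ) + y * Complex.I)‖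
        ≤ S T * |-ξ₀ - -(ξ₀ + T)| := by
      refine intervalIntegral.norm_integral_le_of_norm_le_const fun y hy => ?_
      refine h1 _ ?_ ?_
      · simpa using hu y hy
      · simp [abs_of_pos hT]
    have e3 : ‖∫ y in (-(ξ₀ + T))..(-ξ₀), H (((-T : ℝ) : ℂ) + y * Complex.I)‖
        ≤ S T * |-ξ₀ - -(ξ₀ + T)| := by
      refine intervalIntegral.norm_integral_le_of_norm_le_const fun y hy => ?_
      refine h1 _ ?_ ?_
      · simpa using hu y hy
      · simp [abs_of_pos hT]
    have e4 : (∫ u in (-T)..T, H (u - Complex.I * ξ₀))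
        = ∫ u in (-T)..T, H (u + ((-ξ₀ : ℝ) : ℂ) * Complex.I) := by
      congr 1; funext u; congr 1; push_cast; ring
    have e5 : (∫ u in (-T)..T, H (u - Complex.I * ξ₀)) =
      (∫ u in (-T)..T, H (u + ((-(ξ₀ + T) : ℝ) : ℂ) * Complex.I))
      + Complex.I • (∫ y in (-(ξ₀ + T))..(-ξ₀), H ((T : ℂ) + y * Complex.I))
      - Complex.I • (∫ y in (-(ξ₀ + T))..(-ξ₀), H (((-T : ℝ) : ℂ) + y * Complex.I)) := by
      rw [e4]; linear_combination -hrect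
    rw [e5]
    refine (norm_sub_le _ _).trans ?_
    refine (add_le_add_left (norm_add_le _ _) _).trans ?_
    rw [norm_smul, norm_smul, Complex.norm_I, one_mul, one_mul]
    rw [show |T - -T| = 2 * T by rw [abs_of_pos] <;> linarith] at e1
    rw [show |-ξ₀ - -(ξ₀ + T)| = T by rw [abs_of_pos] <;> linarith] at e2 e3
    linarith
  · rintro z ⟨_, hz⟩
    simp only [mem_preimage] at hz
    rw [uIcc_of_le (by linarith)] at hz
    exact hz.2

lemma cauchy_kernel_tendsto (a : ℝ) (ha : 0 < a) :
    Tendsto (fun T : ℝ => ∫ u in (-T)..T,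
      (1 / ((u : ℂ) + Complex.I * a) - 1 / ((u : ℂ) - Complex.I * a)))
      atTop (nhds (-2 * Complex.I * Real.pi)) := by
  have hf : ∀ u : ℝ, (1 / ((u : ℂ) + Complex.I * a) - 1 / ((u : ℂ) - Complex.I * a))
      = (-2 * Complex.I * (a : ℂ)⁻¹) * (((1 + (u / a) ^ 2)⁻¹ : ℝ) : ℂ) := by
    intro u
    have h1 : (u : ℂ) + Complex.I * a ≠ 0 := by
      intro h; have := congrArg Complex.im h; simp at this; exact ha.ne' this
    have h2 : (u : ℂ) - Complex.I * a ≠ 0 := by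
      intro h; have := congrArg Complex.im h; simp at this; exact ha.ne' this
    have h3 : (a : ℂ) ≠ 0 := by exact_mod_cast ha.ne'
    have h4 : ((1 + (u / a) ^ 2 : ℝ) : ℂ) ≠ 0 := by
      have : (0:ℝ) < 1 + (u / a) ^ 2 := by positivity
      exact_mod_cast this.ne'
    rw [Complex.ofReal_inv]
    have h5 : ((1 + (u / a) ^ 2 : ℝ) : ℂ)
        = ((u : ℂ) + Complex.I * a) * ((u : ℂ) - Complex.I * a) / (a : ℂ) ^ 2 := by
      push_cast
      rw [eq_div_iff (pow_ne_zero 2 h3), add_mul, div_pow, div_mul_cancel₀ _ (pow_ne_zero 2 h3)]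
      linear_combination (a : ℂ) ^ 2 * Complex.I_sq
    rw [h5]
    field_simp
    ring
  have hi : Integrable (fun u : ℝ => (1 + (u / a) ^ 2)⁻¹) :=
    integrable_inv_one_add_sq.comp_div ha.ne'
  have hI : ∫ u : ℝ, (1 + (u / a) ^ 2)⁻¹ = a * Real.pi := by
    rw [Measure.integral_comp_div (fun u : ℝ => (1 + u ^ 2)⁻¹) a, integral_univ_inv_one_add_sq,
      abs_of_pos ha, smul_eq_mul]
  have ht := intervalIntegral_tendsto_integral hi tendsto_neg_atTop_atBot tendsto_id
  rw [hI] at ht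
  have ht2 := ((Complex.continuous_ofReal.tendsto _).comp ht).const_mul
    (-2 * Complex.I * (a : ℂ)⁻¹)
  have h3 : (a : ℂ) ≠ 0 := by exact_mod_cast ha.ne'
  have he : (-2 * Complex.I * (a : ℂ)⁻¹) * ((a * Real.pi : ℝ) : ℂ) = -2 * Complex.I * Real.pi := by
    push_cast; field_simp
  rw [he] at ht2
  refine ht2.congr fun T => ?_
  simp only [Function.comp, id]
  rw [← intervalIntegral.integral_ofReal, ← intervalIntegral.integral_const_mul]
  exact intervalIntegral.integral_congr fun u _ => (hf u).symm

section
variable {φm : Measure ℝ}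

/-- Strict monotonicity on the negative imaginary axis. -/
lemma psi_axis_lt (hm : Integrable (fun x : ℝ => min (x ^ 2) |x|) (φm.restrict (Iio 0)))
    (hφ : 0 < φm (Iio 0)) (z w : ℂ) (hz : z.re = 0) (hw : w.re = 0) (hz0 : z.im < 0)
    (hlt : w.im < z.im) : (psiSemi φm z).re < (psiSemi φm w).re := by
  obtain ⟨i1, e1⟩ := psi_re hm z hz0.le
  obtain ⟨i2, e2⟩ := psi_re hm w (hlt.trans hz0).le
  rw [e1, e2, ← sub_pos, ← integral_sub i2 i1]
  refine semi_pos_of_pos (i2.sub i1) (fun x hx => ?_) hφ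
  simp only [hz, hw, zero_mul, Real.cos_zero, mul_one]
  -- with `p = -z.im * x < 0` and `q = -w.im * x < p`
  have hq : -w.im * x < -z.im * x := by nlinarith
  have hp : -z.im * x < 0 := by nlinarith
  have h1 : Real.exp (-w.im * x)
      = Real.exp (-z.im * x) * Real.exp (-w.im * x - -z.im * x) := by
    rw [← Real.exp_add]; congr 1; ring
  have h2 := Real.add_one_le_exp (-w.im * x - -z.im * x)
  have h3 : Real.exp (-z.im * x) < 1 := by rw [← Real.exp_zero]; exact Real.exp_lt_exp.2 hp
  have h4 := Real.exp_pos (-z.im * x)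
  have h5 := mul_le_mul_of_nonneg_left h2 h4.le
  rw [h1]
  nlinarith

/-- Everything in terms of abstract tail bounds. -/
lemma contour_core (α A : ℝ) (h1 : 1 < α) (hA : 0 < A)
    (hm : Integrable (fun x : ℝ => min (x ^ 2) |x|) (φm.restrict (Iio 0)))
    (hAt : ∀ t : ℝ, 0 < t → ENNReal.ofReal (A * t ^ (-α)) ≤ φm (Iio (-t)))
    (x s ξ₀ k : ℝ) (hx : 0 < x) (h0 : 0 < ξ₀) (hk : ξ₀ < k)
    (hψ : psiSemi φm (-(Complex.I * (k : ℂ))) = (s : ℂ)) :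
    Tendsto
        (fun T : ℝ => ∫ u in (-T)..T,
            Complex.exp (-(Complex.I * ((u : ℂ) - Complex.I * (ξ₀ : ℂ)) * (x : ℂ))) /
              ((s : ℂ) - psiSemi φm ((u : ℂ) - Complex.I * (ξ₀ : ℂ))))
        atTop
        (nhds (2 * Real.pi * ((Real.exp (-(x * k)) /
          (∫ y in Iio (0 : ℝ), y * (Real.exp (k * y) - 1) ∂φm) : ℝ) : ℂ))) := by
  have hφ1 : 0 < φm (Iio (-1)) :=
    lt_of_lt_of_le (by simpa using hA) (hAt 1 one_pos)
  have hφ0 : 0 < φm (Iio 0) := hφ1.trans_le (measure_mono (Iio_subset_Iio (by norm_num)))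
  set z₀ : ℂ := -(Complex.I * (k : ℂ)) with hz₀
  have hz₀re : z₀.re = 0 := by simp [hz₀]
  have hz₀im : z₀.im = -k := by simp [hz₀]
  set U : Set ℂ := {z | z.im < 0} with hU
  have hUo : IsOpen U := isOpen_lt Complex.continuous_im continuous_const
  have hz₀U : z₀ ∈ U := by change z₀.im < 0; linarith
  have hUn : U ∈ nhds z₀ := hUo.mem_nhds hz₀U
  set F : ℂ → ℂ := fun z => s - psiSemi φm z with hF
  have hFz₀ : F z₀ = 0 := by simp only [hF]; rw [hψ]; ring
  -- the derivative
  set D : ℝ := ∫ y in Iio (0 : ℝ), y * (Real.exp (k * y) - 1) ∂φm with hD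
  have hcong : ∀ y : ℝ, Complex.I * y * (Complex.exp (Complex.I * z₀ * (y : ℂ)) - 1)
      = Complex.I * ((y * (Real.exp (k * y) - 1) : ℝ) : ℂ) := by
    intro y
    have : Complex.I * z₀ * (y : ℂ) = ((k * y : ℝ) : ℂ) := by
      rw [hz₀]; push_cast; linear_combination (-(k : ℂ) * y) * Complex.I_sq
    rw [this]; push_cast; ring
  have hDi : Integrable (fun y : ℝ => y * (Real.exp (k * y) - 1)) (φm.restrict (Iio 0)) := by
    have := (semi_integrable' hm z₀ (by linarith)).im
    refine this.congr (Eventually.of_forall fun y => ?_)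
    simp only [hcong y]
    rw [RCLike.im_to_complex, Complex.I_mul_im, Complex.ofReal_re]
  have hDpos : 0 < D := by
    refine semi_pos_of_pos hDi (fun y hy => ?_) hφ0
    have : Real.exp (k * y) < 1 := by
      rw [← Real.exp_zero]; exact Real.exp_lt_exp.2 (by nlinarith)
    nlinarith
  have hFd : HasDerivAt F (-(Complex.I * D)) z₀ := by
    have := (semi_hasDerivAt hm z₀ (by linarith)).const_sub (s : ℂ)
    refine this.congr_deriv ?_
    rw [hD, ← integral_complex_ofReal, ← integral_const_mul]
    congr 1
    exact integral_congr_ae (Eventually.of_forall hcong)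
  have hFdiff : DifferentiableOn ℂ F U := fun z hz =>
    ((semi_hasDerivAt hm z hz).const_sub (s : ℂ)).differentiableAt.differentiableWithinAt
  -- lower bounds of `F`
  have hFim : ∀ z : ℂ, z.im ≤ 0 → z.re ≠ 0 → A * (2 / |z.re|) ^ (-α) ≤ ‖F z‖ := by
    intro z hz hre
    refine (psi_im_lower hm α A hAt z hz hre).trans ?_
    have : |(F z).im| = |(psiSemi φm z).im| := by simp [hF]
    rw [← this]; exact Complex.abs_im_le_norm _
  have hF0 : ∀ z ∈ U, z ≠ z₀ → F z ≠ 0 := by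
    intro z hz hne
    by_cases hre : z.re = 0
    · have him : z.im ≠ z₀.im := fun h => hne (Complex.ext (hre.trans hz₀re.symm) h)
      intro hFz
      have hs : (psiSemi φm z).re = (psiSemi φm z₀).re := by
        rw [hψ, ← sub_eq_zero.1 hFz]
      rcases lt_or_gt_of_ne him with h | h
      · have := psi_axis_lt hm hφ0 z₀ z hz₀re hre hz₀U h
        linarith
      · have := psi_axis_lt hm hφ0 z z₀ hre hz₀re hz h
        linarith
    · intro hFz
      have := hFim z (le_of_lt hz) hre
      rw [hFz, norm_zero] at this
      have h2 : 0 < A * (2 / |z.re|) ^ (-α) := by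
        have := abs_pos.2 hre
        positivity
      linarith
  -- remove the pole
  set d : ℂ → ℂ := dslope F z₀ with hd
  have hdd : DifferentiableOn ℂ d U := (Complex.differentiableOn_dslope hUn).2 hFdiff
  have hd0 : d z₀ = -(Complex.I * D) := by rw [hd, dslope_same, hFd.deriv]
  have hdne : ∀ z, z ≠ z₀ → d z = F z / (z - z₀) := by
    intro z hz
    rw [hd, dslope_of_ne _ hz, slope_def_field, hFz₀, sub_zero]
  have hdn : ∀ z ∈ U, d z ≠ 0 := by
    intro z hz
    by_cases h : z = z₀
    · rw [h, hd0]
      refine neg_ne_zero.2 (mul_ne_zero Complex.I_ne_zero ?_)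
      exact_mod_cast hDpos.ne'
    · rw [hdne z h]
      exact div_ne_zero (hF0 z hz h) (sub_ne_zero.2 h)
  set E : ℂ → ℂ := fun z => Complex.exp (-(Complex.I * z * (x : ℂ))) / d z with hE
  have hEd : DifferentiableOn ℂ E U :=
    DifferentiableOn.div (Differentiable.differentiableOn (by fun_prop)) hdd hdn
  set R : ℂ := E z₀ with hR
  set a : ℝ := k - ξ₀ with ha
  have hapos : 0 < a := by linarith
  set w : ℂ := Complex.I * (a - ξ₀ : ℝ) with hw
  have hwre : w.re = 0 := by simp [hw]
  have hwim : w.im = a - ξ₀ := by simp [hw]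
  set H : ℂ → ℂ := fun z => dslope E z₀ z + R / (z - w) with hH
  have hHd : DifferentiableOn ℂ H {z | z.im ≤ -ξ₀} := by
    have hsub : {z : ℂ | z.im ≤ -ξ₀} ⊆ U := fun z (hz : z.im ≤ -ξ₀) => by
      change z.im < 0; linarith
    refine DifferentiableOn.add (((Complex.differentiableOn_dslope hUn).2 hEd).mono hsub) ?_
    refine DifferentiableOn.div (differentiableOn_const _)
      (Differentiable.differentiableOn (by fun_prop)) ?_
    intro z (hz : z.im ≤ -ξ₀) h
    have := congrArg Complex.im h
    rw [Complex.sub_im, hwim, Complex.zero_im] at this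
    linarith
  have hHeq : ∀ z, z ≠ z₀ → H z = Complex.exp (-(Complex.I * z * (x : ℂ))) / F z
      - R * (1 / (z - z₀) - 1 / (z - w)) := by
    intro z hz
    have hz' := sub_ne_zero.2 hz
    simp only [hH]
    rw [dslope_of_ne _ hz, slope_def_field, ← hR]
    simp only [hE]
    rw [hdne z hz]
    have : Complex.exp (-(Complex.I * z * (x : ℂ))) / (F z / (z - z₀)) / (z - z₀)
        = Complex.exp (-(Complex.I * z * (x : ℂ))) / F z := by
      rw [div_div_eq_mul_div, div_right_comm, mul_div_assoc, div_self hz', mul_one]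
    rw [sub_div, this]
    ring
  have hexp : ∀ z : ℂ, ‖Complex.exp (-(Complex.I * z * (x : ℂ)))‖ = Real.exp (z.im * x) := by
    intro z
    rw [Complex.norm_exp, Complex.neg_re, re_Izx]; congr 1; ring
  have hHnorm : ∀ z : ℂ, ∀ δ p q : ℝ, 0 < δ → 0 < p → 0 < q → δ ≤ ‖F z‖ → p ≤ ‖z - z₀‖ →
      q ≤ ‖z - w‖ → ‖H z‖ ≤ Real.exp (z.im * x) / δ + ‖R‖ * (2 * a / (p * q)) := by
    intro z δ p q hδ hp hq h2 h3 h4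
    have hzz : z - z₀ ≠ 0 := norm_pos_iff.1 (hp.trans_le h3)
    have hzw : z - w ≠ 0 := norm_pos_iff.1 (hq.trans_le h4)
    rw [hHeq z (sub_ne_zero.1 hzz)]
    refine (norm_sub_le _ _).trans (add_le_add ?_ ?_)
    · rw [norm_div, hexp]
      gcongr
    · rw [norm_mul]
      refine mul_le_mul_of_nonneg_left ?_ (norm_nonneg _)
      rw [div_sub_div _ _ hzz hzw, norm_div, norm_mul]
      have : 1 * (z - w) - (z - z₀) * 1 = -(Complex.I * ((2 * a : ℝ) : ℂ)) := by
        rw [hz₀, hw, ha]; push_cast; ring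
      rw [this, norm_neg, norm_mul, Complex.norm_I, one_mul, Complex.norm_real, Real.norm_eq_abs,
        abs_of_pos (by positivity)]
      gcongr
  obtain ⟨k₀, hk₀, hre⟩ := psi_re_lower hm hφ1 (s + 1)
  set C : ℝ := A * 2 ^ (-α) with hC
  have hCpos : 0 < C := by positivity
  have hFim' : ∀ z : ℂ, z.im ≤ 0 → z.re ≠ 0 → C * |z.re| ^ α ≤ ‖F z‖ := by
    intro z hz hr
    refine le_trans (le_of_eq ?_) (hFim z hz hr)
    rw [Real.div_rpow (by norm_num) (abs_nonneg _), Real.rpow_neg (abs_nonneg _), div_inv_eq_mul, hC]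
    ring
  have htop : Tendsto (fun T : ℝ => ∫ u in (-T)..T, H (u - Complex.I * ξ₀)) atTop (nhds 0) := by
    refine contour_top_tendsto H ξ₀
      (fun T => 1 / (C * T ^ α) + ‖R‖ * (2 * a / (T * T)))
      (fun T => Real.exp (-(x * T)) / min 1 C + ‖R‖ * (2 * a / (T / 2 * T))) hHd ?_ ?_ ?_ ?_
    · filter_upwards [eventually_gt_atTop 0] with T hT z hz hzT
      have hr : z.re ≠ 0 := by rw [← abs_pos, hzT]; exact hT
      have hb := hFim' z (by linarith) hr
      rw [hzT] at hb
      refine (hHnorm z (C * T ^ α) T T (by positivity) hT hT hb ?_ ?_).trans ?_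
      · rw [← hzT]
        have := Complex.abs_re_le_norm (z - z₀)
        rwa [Complex.sub_re, hz₀re, sub_zero] at this
      · rw [← hzT]
        have := Complex.abs_re_le_norm (z - w)
        rwa [Complex.sub_re, hwre, sub_zero] at this
      · have : Real.exp (z.im * x) ≤ 1 := Real.exp_le_one_iff.2 (by nlinarith)
        gcongr
    · filter_upwards [eventually_ge_atTop k₀, eventually_ge_atTop (2 * a)] with T hT1 hT2 z hz
      have hT : 0 < T := hk₀.trans_le hT1
      refine (hHnorm z (min 1 C) (T / 2) T (by positivity) (by positivity) hT ?_ ?_ ?_).trans ?_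
      · by_cases hr : |z.re| ≤ 1
        · refine (min_le_left _ _).trans ?_
          have h2 := hre z (by linarith) hr
          have h3 := Complex.abs_re_le_norm (F z)
          have h4 : (F z).re = s - (psiSemi φm z).re := by simp [hF]
          rw [h4] at h3
          have := neg_abs_le (s - (psiSemi φm z).re)
          linarith
        · refine (min_le_right _ _).trans ?_
          have hr' := (not_le.1 hr).le
          have h2 := hFim' z (by linarith) (abs_pos.1 (by linarith))
          have h3 : 1 ≤ |z.re| ^ α := Real.one_le_rpow hr' (by linarith)
          nlinarith
      · have := Complex.abs_im_le_norm (z - z₀)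
        rw [Complex.sub_im, hz₀im, hz] at this
        have h2 := neg_abs_le (-(ξ₀ + T) - -k)
        linarith
      · have := Complex.abs_im_le_norm (z - w)
        rw [Complex.sub_im, hwim, hz] at this
        have h2 := neg_abs_le (-(ξ₀ + T) - (a - ξ₀))
        linarith
      · have : Real.exp (z.im * x) ≤ Real.exp (-(x * T)) := Real.exp_le_exp.2 (by rw [hz]; nlinarith)
        gcongr
    · have l1 : Tendsto (fun T : ℝ => C⁻¹ * T ^ (-(α - 1))) atTop (nhds 0) := by
        simpa using (tendsto_rpow_neg_atTop (by linarith : 0 < α - 1)).const_mul C⁻¹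
      have l2 : Tendsto (fun T : ℝ => (‖R‖ * (2 * a)) * T⁻¹) atTop (nhds 0) := by
        simpa using tendsto_inv_atTop_zero.const_mul (‖R‖ * (2 * a))
      have l3 := l1.add l2
      rw [add_zero] at l3
      refine l3.congr' ?_
      filter_upwards [eventually_gt_atTop 0] with T hT
      rw [neg_sub, Real.rpow_sub hT, Real.rpow_one]
      have : T ^ α ≠ 0 := by positivity
      field_simp
    · have l1 : Tendsto (fun T : ℝ => (min 1 C)⁻¹ * (T * Real.exp (-(x * T)))) atTop (nhds 0) := by
        have := tendsto_rpow_mul_exp_neg_mul_atTop_nhds_zero 1 x hx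
        simp only [Real.rpow_one, neg_mul] at this
        simpa using this.const_mul (min 1 C)⁻¹
      have l2 : Tendsto (fun T : ℝ => (‖R‖ * (4 * a)) * T⁻¹) atTop (nhds 0) := by
        simpa using tendsto_inv_atTop_zero.const_mul (‖R‖ * (4 * a))
      have l3 := l1.add l2
      rw [add_zero] at l3
      refine l3.congr' ?_
      filter_upwards [eventually_gt_atTop 0] with T hT
      have : min 1 C ≠ 0 := by positivity
      field_simp
      ring
  have hker := (cauchy_kernel_tendsto a hapos).const_mul R
  have hsum := htop.add hker
  have hval : 0 + R * (-2 * Complex.I * Real.pi) =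
      2 * Real.pi * ((Real.exp (-(x * k)) / D : ℝ) : ℂ) := by
    have hDc : (D : ℂ) ≠ 0 := by exact_mod_cast hDpos.ne'
    have hex : Complex.exp (-(Complex.I * z₀ * (x : ℂ))) = ((Real.exp (-(x * k)) : ℝ) : ℂ) := by
      rw [Complex.ofReal_exp]; congr 1
      rw [hz₀]; push_cast; linear_combination ((k : ℂ) * x) * Complex.I_sq
    rw [hR]
    simp only [hE]
    rw [hd0, hex]
    rw [Complex.ofReal_div]
    have := Complex.I_ne_zero
    field_simp
    ring
  rw [hval] at hsum
  refine hsum.congr fun T => ?_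
  have hline : ∀ u : ℝ, ((u : ℂ) - Complex.I * ξ₀).im = -ξ₀ := by intro u; simp
  have hc1 : Continuous (fun u : ℝ => H (u - Complex.I * ξ₀)) := by
    refine hHd.continuousOn.comp_continuous (by fun_prop) fun u => ?_
    exact (hline u).le
  have hc2 : Continuous (fun u : ℝ =>
      R * (1 / ((u : ℂ) + Complex.I * a) - 1 / ((u : ℂ) - Complex.I * a))) := by
    refine continuous_const.mul (Continuous.sub ?_ ?_)
    · refine continuous_const.div (by fun_prop) fun u h => ?_
      have := congrArg Complex.im h; simp at this; exact hapos.ne' this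
    · refine continuous_const.div (by fun_prop) fun u h => ?_
      have := congrArg Complex.im h; simp at this; exact hapos.ne' this
  rw [← intervalIntegral.integral_const_mul, ← intervalIntegral.integral_add
    (hc1.intervalIntegrable _ _) (hc2.intervalIntegrable _ _)]
  refine intervalIntegral.integral_congr fun u _ => ?_
  have hne : (u : ℂ) - Complex.I * ξ₀ ≠ z₀ := by
    intro h
    have := congrArg Complex.im h
    rw [hline, hz₀im] at this
    linarith
  rw [hHeq _ hne]
  have e1 : (u : ℂ) - Complex.I * ξ₀ - z₀ = u + Complex.I * a := by
    rw [hz₀, ha]; push_cast; ring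
  have e2 : (u : ℂ) - Complex.I * ξ₀ - w = u - Complex.I * a := by
    rw [hw]; push_cast; ring
  rw [e1, e2]
  simp only [hF]
  ring

end

/-- shifted-contour Fourier inversion. For `0 < ξ₀ < ξ(s)`,
`(1/2π) lim_{T→∞} ∫_{-T}^{T} e^{-i(u - iξ₀)x} / (s - ψ(u - iξ₀)) du
  = e^{-x ξ(s)} / s'(ξ(s))`. -/
theorem contour_fourier_inversion
    (α c : ℝ) (hα : 1 < α ∧ α < 2) (hc : 1 < c)
    (θ : ℝ → ℝ) (hθc : Continuous θ) (hθpos : ∀ y : ℝ, 0 < θ y)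
    (hθper : Function.Periodic θ (Real.log (c ^ (1 / α))))
    (hθmono : AntitoneOn (fun x : ℝ => x ^ (-α) * θ (Real.log x)) (Set.Ioi 0))
    (φm : MeasureTheory.Measure ℝ)
    (hφtail : ∀ x : ℝ, 0 < x → φm (Set.Iio (-x)) = ENNReal.ofReal (x ^ (-α) * θ (Real.log x)))
    (hφsupp : φm (Set.Ici 0) = 0)
    (ξ : ℝ → ℝ)
    (hξ : ∀ s : ℝ, 0 < s → 0 < ξ s ∧ psiSemi φm (-(Complex.I * (ξ s : ℂ))) = (s : ℂ)) :
    ∀ x s ξ₀ : ℝ, 0 < x → 0 < s → 0 < ξ₀ → ξ₀ < ξ s →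
      Filter.Tendsto
        (fun T : ℝ => (1 / (2 * (Real.pi : ℂ))) *
          ∫ u in Set.Ioo (-T) T,
            Complex.exp (-(Complex.I * ((u : ℂ) - Complex.I * (ξ₀ : ℂ)) * (x : ℂ))) /
              ((s : ℂ) - psiSemi φm ((u : ℂ) - Complex.I * (ξ₀ : ℂ))))
        Filter.atTop
        (nhds (((Real.exp (-(x * ξ s)) /
          (∫ y in Set.Iio (0 : ℝ), y * (Real.exp (ξ s * y) - 1) ∂φm) : ℝ) : ℂ))) := by
  obtain ⟨A, B, hA, hB, hAB⟩ := semi_tail_bounds α c hα.1 hc θ hθc hθpos hθper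
  have hlow : ∀ t : ℝ, 0 < t → ENNReal.ofReal (A * t ^ (-α)) ≤ φm (Iio (-t)) := by
    intro t ht
    rw [hφtail t ht]
    refine ENNReal.ofReal_le_ofReal ?_
    have := Real.rpow_pos_of_pos ht (-α)
    nlinarith [(hAB (Real.log t)).1]
  have hup : ∀ t : ℝ, 0 < t → φm (Iio (-t)) ≤ ENNReal.ofReal (B * t ^ (-α)) := by
    intro t ht
    rw [hφtail t ht]
    refine ENNReal.ofReal_le_ofReal ?_
    have := Real.rpow_pos_of_pos ht (-α)
    nlinarith [(hAB (Real.log t)).2]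
  have hm := semi_integrable_min α hα.1 hα.2 φm B hup
  intro x s ξ₀ hx hs h0 hlt
  have hcore := contour_core α A hα.1 hA hm hlow x s ξ₀ (ξ s) hx h0 hlt (hξ s hs).2
  have h := hcore.const_mul (1 / (2 * (Real.pi : ℂ)))
  have hpi : (2 * (Real.pi : ℂ)) ≠ 0 := by
    exact_mod_cast (by positivity : (2 * Real.pi) ≠ 0)
  rw [← mul_assoc, one_div_mul_cancel hpi, one_mul] at h
  refine h.congr' ?_
  filter_upwards [eventually_gt_atTop 0] with T hT
  rw [intervalIntegral.integral_of_le (by linarith), integral_Ioc_eq_integral_Ioo]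
end
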